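/- Let α > 0, m > α, and let f be the unique density solution to the equation x^m f(x) = (1/Γ(α)) ∫_0^x (x−v)^{α−1} f(v) dv on (0,∞). Then there exists a constant c > 0 such that f(x) · x^{m(1+α)/(2α)} · exp( (α/(m−α)) · x^{(α−m)/α} ) tends to c as x → 0+; that is, f(x) ∼ c · x^{−m(1+α)/(2α)} · exp( −(α/(m−α)) x^{(α−m)/α} ) as x → 0+. -/

import Mathlib

open MeasureTheory Real Set Filter

noncomputable section

/-- `f` is a density solution to the integro-differential equation
`I^α_{0+} f = x^m f` on `(0,∞)`: `f` is measurable, nonnegative on `(0,∞)`,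
integrates to `1` on `(0,∞)`, and satisfies
`x^m f(x) = (1/Γ(α)) ∫_0^x (x−v)^{α−1} f(v) dv` for every `x > 0`. -/
def IsDensitySolution (α m : ℝ) (f : ℝ → ℝ) : Prop :=
  Measurable f ∧ (∀ x ∈ Set.Ioi (0:ℝ), 0 ≤ f x) ∧
  (∫ x in Set.Ioi (0:ℝ), f x) = 1 ∧
  ∀ x ∈ Set.Ioi (0:ℝ),
    x ^ m * f x = (1 / Real.Gamma α) * ∫ v in Set.Ioo (0:ℝ) x, (x - v) ^ (α - 1) * f v

open scoped ENNReal Topology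

lemma log_Gamma_add_sub_le {α u : ℝ} (hα : 0 < α) (hu : 0 < u) :
    log (Gamma (u + α)) - log (Gamma u) ≤ α * log (u + α) := by
  have h := convexOn_log_Gamma.slope_mono_adjacent (x := u) (y := u + α) (z := u + α + 1)
    (by simpa using hu) (by simp; linarith) (by linarith) (by linarith)
  have hG : log (Gamma (u + α + 1)) = log (u + α) + log (Gamma (u + α)) := by
    rw [Gamma_add_one (by linarith), log_mul (by linarith) (Gamma_pos_of_pos (by linarith)).ne']
  simp only [Function.comp_apply, hG] at h
  rw [div_le_div_iff₀ (by linarith) (by linarith)] at h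
  nlinarith

lemma le_log_Gamma_add_sub {α u : ℝ} (hα : 0 < α) (hu : 1 < u) :
    α * log (u - 1) ≤ log (Gamma (u + α)) - log (Gamma u) := by
  have h := convexOn_log_Gamma.slope_mono_adjacent (x := u - 1) (y := u) (z := u + α)
    (by simpa using hu) (by simp; linarith) (by linarith) (by linarith)
  have hG : log (Gamma u) = log (u - 1) + log (Gamma (u - 1)) := by
    conv_lhs => rw [← sub_add_cancel u 1]
    rw [Gamma_add_one (by linarith), log_mul (by linarith) (Gamma_pos_of_pos (by linarith)).ne']
  simp only [Function.comp_apply] at h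
  rw [div_le_div_iff₀ (by linarith) (by linarith)] at h
  nlinarith

lemma tendsto_log_Gamma_add_sub_atTop {α : ℝ} (hα : 0 < α) :
    Tendsto (fun u => log (Gamma (u + α)) - log (Gamma u)) atTop atTop := by
  refine tendsto_atTop_mono' _ ?_ ((tendsto_log_atTop.comp
    (tendsto_atTop_add_const_right atTop (-1) tendsto_id)).const_mul_atTop hα)
  filter_upwards [eventually_gt_atTop 1] with u hu
  simpa [sub_eq_add_neg] using le_log_Gamma_add_sub hα hu

lemma tendsto_log_add_sub_log_add (a b : ℝ) :
    Tendsto (fun u => log (u + a) - log (u + b)) atTop (𝓝 0) := by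
  have h (c : ℝ) : Tendsto (fun u => log (u + c) - log u) atTop (𝓝 0) := by
    have h1 : Tendsto (fun u : ℝ => 1 + c * u⁻¹) atTop (𝓝 (1 + c * 0)) :=
      (tendsto_inv_atTop_zero.const_mul c).const_add 1
    rw [mul_zero, add_zero] at h1
    have h2 := (continuousAt_log (one_ne_zero)).tendsto.comp h1
    rw [log_one] at h2
    refine h2.congr' ?_
    filter_upwards [eventually_gt_atTop 0, eventually_gt_atTop (-c)] with u hu hc
    rw [← log_div (by linarith) hu.ne']
    simp only [Function.comp_apply]
    congr 1
    field_simp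
  simpa using (h a).sub (h b)

lemma tendsto_log_Gamma_ratio_shift {α δ : ℝ} (hα : 0 < α) (hδ : 0 < δ) :
    Tendsto (fun u => (log (Gamma (u + δ + α)) - log (Gamma (u + δ))) -
      (log (Gamma (u + α)) - log (Gamma u))) atTop (𝓝 0) := by
  have hup : Tendsto (fun u : ℝ => α * (log (u + (δ + α)) - log (u + -1))) atTop (𝓝 0) := by
    simpa using (tendsto_log_add_sub_log_add (δ + α) (-1)).const_mul α
  have hlo : Tendsto (fun u : ℝ => α * (log (u + (δ - 1)) - log (u + α))) atTop (𝓝 0) := by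
    simpa using (tendsto_log_add_sub_log_add (δ - 1) α).const_mul α
  refine tendsto_of_tendsto_of_tendsto_of_le_of_le' hlo hup ?_ ?_
  all_goals
    filter_upwards [eventually_gt_atTop 1] with u hu
    have h1 := log_Gamma_add_sub_le hα (u := u) (by linarith)
    have h2 := le_log_Gamma_add_sub hα hu
    have h3 := log_Gamma_add_sub_le hα (u := u + δ) (by linarith)
    have h4 := le_log_Gamma_add_sub hα (u := u + δ) (by linarith)
    simp only [show u + (δ - 1) = u + δ - 1 by ring, show u + (δ + α) = u + δ + α by ring,
      show u + -1 = u - 1 by ring]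
    linarith

/-- The kernel of `F ↦ x ^ (-m) I^α_{0+} F`. -/
def fracKernel (α m : ℝ) (p : ℝ × ℝ) : ℝ≥0∞ :=
  {p : ℝ × ℝ | 0 < p.2 ∧ p.2 < p.1}.indicator
    (fun p => ENNReal.ofReal ((p.1 - p.2) ^ (α - 1) / (Gamma α * p.1 ^ m))) p

/-- The operator `F ↦ x ^ (-m) I^α_{0+} F` on nonnegative functions. -/
def fracOp (α m : ℝ) (F : ℝ → ℝ≥0∞) (x : ℝ) : ℝ≥0∞ :=
  ∫⁻ v, fracKernel α m (x, v) * F v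

/-- The moment of order `-u` of the density `F` on `(0, ∞)`. -/
def negMoment (F : ℝ → ℝ≥0∞) (u : ℝ) : ℝ≥0∞ :=
  ∫⁻ x in Ioi 0, ENNReal.ofReal (x ^ (-u)) * F x

lemma measurable_fracKernel (α m : ℝ) : Measurable (fracKernel α m) := by
  refine Measurable.indicator (by fun_prop) ?_
  exact (measurableSet_lt measurable_const measurable_snd).inter
    (measurableSet_lt measurable_snd measurable_fst)

lemma measurable_fracOp (α m : ℝ) {F : ℝ → ℝ≥0∞} (hF : Measurable F) :
    Measurable (fracOp α m F) :=
  Measurable.lintegral_prod_right' (f := fun p : ℝ × ℝ => fracKernel α m p * F p.2)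
    ((measurable_fracKernel α m).mul (hF.comp measurable_snd))

lemma fracOp_mono {α m x : ℝ} {F G : ℝ → ℝ≥0∞} (h : ∀ v ∈ Ioo 0 x, F v ≤ G v) :
    fracOp α m F x ≤ fracOp α m G x := by
  refine lintegral_mono fun v => ?_
  by_cases hv : v ∈ Ioo 0 x
  · exact mul_le_mul_right (h v hv) _
  · have : fracKernel α m (x, v) = 0 :=
      indicator_of_notMem (s := {p : ℝ × ℝ | 0 < p.2 ∧ p.2 < p.1}) hv _
    simp [this]

lemma fracOp_eq (α m x : ℝ) (F : ℝ → ℝ≥0∞) :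
    fracOp α m F x =
      ∫⁻ v in Ioo 0 x, ENNReal.ofReal ((x - v) ^ (α - 1) / (Gamma α * x ^ m)) * F v := by
  rw [fracOp, ← lintegral_indicator measurableSet_Ioo]
  refine lintegral_congr fun v => ?_
  by_cases hv : v ∈ Ioo 0 x
  · rw [indicator_of_mem hv]
    congr 1
    exact indicator_of_mem (s := {p : ℝ × ℝ | 0 < p.2 ∧ p.2 < p.1}) hv _
  · have : fracKernel α m (x, v) = 0 :=
      indicator_of_notMem (s := {p : ℝ × ℝ | 0 < p.2 ∧ p.2 < p.1}) hv _
    simp [this, indicator_of_notMem hv]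

lemma fracOp_iSup (α m : ℝ) {F : ℕ → ℝ → ℝ≥0∞} (hF : ∀ n, Measurable (F n)) (hmono : Monotone F)
    (x : ℝ) : fracOp α m (fun v => ⨆ n, F n v) x = ⨆ n, fracOp α m (F n) x := by
  simp only [fracOp, ENNReal.mul_iSup]
  refine lintegral_iSup (fun n => ?_) fun i j hij v => ?_
  · exact ((measurable_fracKernel α m).comp measurable_prodMk_left).mul (hF n)
  · exact mul_le_mul_right (hmono hij v) _

lemma lintegral_beta {a b : ℝ} (ha : 0 < a) (hb : 0 < b) :
    ∫⁻ s in Ioo (0 : ℝ) 1, ENNReal.ofReal (s ^ (a - 1) * (1 - s) ^ (b - 1)) =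
      ENNReal.ofReal (Gamma a * Gamma b / Gamma (a + b)) := by
  have h := ProbabilityTheory.lintegral_betaPDF_eq_one ha hb
  have hpos := ProbabilityTheory.beta_pos ha hb
  rw [ProbabilityTheory.lintegral_betaPDF] at h
  change _ = ENNReal.ofReal (ProbabilityTheory.beta a b)
  rw [← mul_one (ENNReal.ofReal (ProbabilityTheory.beta a b)), ← h,
    ← lintegral_const_mul' _ _ ENNReal.ofReal_ne_top]
  refine lintegral_congr fun s => ?_
  rw [← ENNReal.ofReal_mul hpos.le]
  congr 1
  field_simp

lemma image_div_Ioo {v : ℝ} (hv : 0 < v) : (fun s => v / s) '' Ioo 0 1 = Ioi v := by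
  ext x
  constructor
  · rintro ⟨s, ⟨h0, h1⟩, rfl⟩
    exact (lt_div_iff₀ h0).2 (by nlinarith)
  · intro hx
    have hx' : v < x := hx
    have : 0 < x := hv.trans hx'
    exact ⟨v / x, ⟨by positivity, (div_lt_one this).2 hx'⟩, by field_simp⟩

lemma lintegral_fracKernel_mul_rpow {α m u v : ℝ} (hα : 0 < α) (hu : 0 < u + (m - α))
    (hv : 0 < v) :
    ∫⁻ x in Ioi v, ENNReal.ofReal (x ^ (-u)) *
        ENNReal.ofReal ((x - v) ^ (α - 1) / (Gamma α * x ^ m)) =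
      ENNReal.ofReal (Gamma (u + (m - α)) / Gamma (u + (m - α) + α)) *
        ENNReal.ofReal (v ^ (-(u + (m - α)))) := by
  have hG := Gamma_pos_of_pos hα
  rw [← image_div_Ioo hv, lintegral_image_eq_lintegral_abs_deriv_mul (f' := fun s => -v / s ^ 2)
    measurableSet_Ioo]
  · have hc : 0 ≤ v ^ (-(u + (m - α))) / Gamma α := by positivity
    have key : ∀ s ∈ Ioo (0 : ℝ) 1, ENNReal.ofReal |-v / s ^ 2| *
        (ENNReal.ofReal ((v / s) ^ (-u)) *
          ENNReal.ofReal ((v / s - v) ^ (α - 1) / (Gamma α * (v / s) ^ m))) =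
        ENNReal.ofReal (v ^ (-(u + (m - α))) / Gamma α) *
          ENNReal.ofReal (s ^ (u + (m - α) - 1) * (1 - s) ^ (α - 1)) := by
      rintro s ⟨h0, h1⟩
      have h1' : 0 < 1 - s := by linarith
      have e1 : v / s - v = v * (1 - s) * s⁻¹ := by field_simp
      rw [← ENNReal.ofReal_mul (by positivity), ← ENNReal.ofReal_mul (by positivity),
        ← ENNReal.ofReal_mul hc]
      congr 1
      rw [neg_div, abs_neg, abs_of_pos (by positivity), e1, mul_rpow (by positivity) (by positivity),
        mul_rpow (by positivity) (by positivity), div_rpow hv.le h0.le, div_rpow hv.le h0.le,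
        inv_rpow h0.le, show -(u + (m - α)) = 1 + -u + (α - 1) + -m by ring,
        show u + (m - α) - 1 = -2 + -(-u) + -(α - 1) + m by ring]
      simp only [rpow_add hv, rpow_add h0, rpow_one, rpow_neg hv.le, rpow_neg h0.le,
        rpow_two]
      field_simp
    rw [setLIntegral_congr_fun measurableSet_Ioo key, lintegral_const_mul' _ _
      ENNReal.ofReal_ne_top, lintegral_beta hu hα, ← ENNReal.ofReal_mul hc,
      ← ENNReal.ofReal_mul (by
        have := Gamma_pos_of_pos hu
        have := Gamma_pos_of_pos (s := u + (m - α) + α) (by linarith)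
        positivity)]
    congr 1
    field_simp
  · intro s hs
    have := (hasDerivAt_inv hs.1.ne').const_mul v
    simpa [div_eq_mul_inv] using this.hasDerivWithinAt
  · intro s hs t ht h
    have := hs.1; have := ht.1
    simp only at h
    field_simp at h
    exact h.symm

lemma negMoment_fracOp {α m u : ℝ} (hα : 0 < α) (hu : 0 < u + (m - α)) {F : ℝ → ℝ≥0∞}
    (hF : Measurable F) :
    negMoment (fracOp α m F) u =
      ENNReal.ofReal (Gamma (u + (m - α)) / Gamma (u + (m - α) + α)) *
        negMoment F (u + (m - α)) := by
  have hK := measurable_fracKernel α m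
  simp only [negMoment, fracOp]
  rw [← lintegral_const_mul' _ _ ENNReal.ofReal_ne_top]
  calc _ = ∫⁻ x in Ioi 0, ∫⁻ v, ENNReal.ofReal (x ^ (-u)) * (fracKernel α m (x, v) * F v) := by
        refine lintegral_congr fun x => ?_
        rw [lintegral_const_mul' _ _ ENNReal.ofReal_ne_top]
    _ = ∫⁻ v, ∫⁻ x in Ioi 0, ENNReal.ofReal (x ^ (-u)) * (fracKernel α m (x, v) * F v) := by
        refine lintegral_lintegral_swap (Measurable.aemeasurable ?_)
        simp only [Function.uncurry_def]
        fun_prop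
    _ = _ := by
        rw [← lintegral_indicator measurableSet_Ioi]
        refine lintegral_congr fun v => ?_
        by_cases hv : 0 < v
        · rw [indicator_of_mem (by exact hv), ← mul_assoc, ← lintegral_fracKernel_mul_rpow hα hu hv,
            ← lintegral_mul_const _ (by fun_prop), ← lintegral_indicator measurableSet_Ioi,
            ← lintegral_indicator measurableSet_Ioi]
          refine lintegral_congr fun x => ?_
          by_cases hx : v < x
          · rw [indicator_of_mem (by exact hv.trans hx), indicator_of_mem (by exact hx), mul_assoc]
            congr 2
            exact indicator_of_mem (s := {p : ℝ × ℝ | 0 < p.2 ∧ p.2 < p.1}) ⟨hv, hx⟩ _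
          · have : fracKernel α m (x, v) = 0 := indicator_of_notMem (fun h => hx h.2) _
            rw [indicator_of_notMem (s := Ioi v) hx]
            simp [this, indicator]
        · have (x : ℝ) : fracKernel α m (x, v) = 0 := indicator_of_notMem (fun h => hv h.1) _
          rw [indicator_of_notMem (by exact hv)]
          simp [this]

lemma ConvexOn.eqOn_of_shift_sub_eq {a δ : ℝ} (ha : a < 0) (hδ : 0 < δ) {φ ψ g : ℝ → ℝ}
    (hφ : ConvexOn ℝ (Ioi a) φ) (hψ : ConvexOn ℝ (Ioi a) ψ)
    (hφg : ∀ u, a < u → φ (u + δ) - φ u = g u) (hψg : ∀ u, a < u → ψ (u + δ) - ψ u = g u)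
    (hg : Tendsto (fun u => g (u + δ) - g u) atTop (𝓝 0)) (h0 : φ 0 = ψ 0) :
    EqOn φ ψ (Ioi a) := by
  have bound {χ : ℝ → ℝ} (hχ : ConvexOn ℝ (Ioi a) χ)
      (hχg : ∀ u, a < u → χ (u + δ) - χ u = g u) {u h : ℝ} (hu : a < u) (hh : 0 < h)
      (hhδ : h ≤ δ) :
      h / δ * g u ≤ χ (u + δ + h) - χ (u + δ) ∧
        χ (u + δ + h) - χ (u + δ) ≤ h / δ * g (u + δ) := by
    have h1 := hχ.slope_mono_adjacent (x := u) (y := u + δ) (z := u + δ + h) hu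
      (by simp; linarith) (by linarith) (by linarith)
    have h2 := hχ.secant_mono (a := u + δ) (x := u + δ + h) (y := u + δ + δ)
      (by simp; linarith) (by simp; linarith) (by simp; linarith) (by linarith) (by linarith)
      (by linarith)
    rw [hχg _ (by linarith)] at h1 h2
    rw [show u + δ - u = δ by ring, show u + δ + h - (u + δ) = h by ring,
      div_le_div_iff₀ hδ hh] at h1
    rw [show u + δ + δ - (u + δ) = δ by ring, show u + δ + h - (u + δ) = h by ring,
      div_le_div_iff₀ hh hδ] at h2
    constructor
    · rw [div_mul_eq_mul_div, div_le_iff₀ hδ]; linarith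
    · rw [div_mul_eq_mul_div, le_div_iff₀ hδ]; linarith
  have per (u : ℝ) (hu : a < u) (n : ℕ) : φ (u + n * δ) - ψ (u + n * δ) = φ u - ψ u := by
    induction n with
    | zero => simp
    | succ n ih =>
      have hp : 0 ≤ n * δ := by positivity
      rw [← ih]
      push_cast
      rw [show u + (n + 1) * δ = u + n * δ + δ by ring]
      linarith [hφg (u + n * δ) (by linarith), hψg (u + n * δ) (by linarith)]
  have step {u h : ℝ} (hu : a < u) (hh : 0 < h) (hhδ : h ≤ δ) :
      φ (u + h) - ψ (u + h) = φ u - ψ u := by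
    have hseq : Tendsto (fun n : ℕ => u + n * δ) atTop atTop :=
      tendsto_atTop_add_const_left _ _ (tendsto_natCast_atTop_atTop.atTop_mul_const hδ)
    have hlim := (hg.comp hseq).const_mul (h / δ)
    rw [mul_zero] at hlim
    have hle : |(φ (u + h) - ψ (u + h)) - (φ u - ψ u)| ≤ 0 := by
      refine ge_of_tendsto' hlim fun n => ?_
      have hp : 0 ≤ n * δ := by positivity
      have e1 := per u hu (n + 1)
      have e2 := per (u + h) (by linarith) (n + 1)
      push_cast at e1 e2
      rw [show u + (n + 1) * δ = u + n * δ + δ by ring] at e1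
      rw [show u + h + (n + 1) * δ = u + n * δ + δ + h by ring] at e2
      obtain ⟨b1, b2⟩ := bound hφ hφg (u := u + n * δ) (by linarith) hh hhδ
      obtain ⟨b3, b4⟩ := bound hψ hψg (u := u + n * δ) (by linarith) hh hhδ
      simp only [Function.comp_apply]
      rw [← e1, ← e2, abs_le, mul_sub]
      constructor <;> linarith
    linarith [abs_nonpos_iff.1 hle]
  have nonneg {u : ℝ} (hu : 0 ≤ u) : φ u = ψ u := by
    set k := ⌊u / δ⌋₊ with hk
    have hk1 : k * δ ≤ u := (le_div_iff₀ hδ).1 (Nat.floor_le (by positivity))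
    have hk2 : u < (k + 1) * δ := (div_lt_iff₀ hδ).1 (Nat.lt_floor_add_one _)
    have e1 := per 0 ha k
    rw [zero_add, h0, sub_self] at e1
    rcases hk1.eq_or_lt with h | h
    · rw [← h]; linarith
    · have hp : 0 ≤ k * δ := by positivity
      have := step (u := k * δ) (h := u - k * δ) (by linarith) (by linarith) (by linarith)
      rw [add_sub_cancel] at this
      linarith
  intro u hu
  obtain ⟨n, hn⟩ := exists_nat_gt (-u / δ)
  have := (div_lt_iff₀ hδ).1 hn
  linarith [per u hu n, nonneg (u := u + n * δ) (by linarith)]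

lemma negMoment_congr {F G : ℝ → ℝ≥0∞} (h : ∀ᵐ x ∂volume.restrict (Ioi (0 : ℝ)), F x = G x)
    (u : ℝ) : negMoment F u = negMoment G u := by
  refine lintegral_congr_ae ?_
  filter_upwards [h] with x hx
  rw [hx]

lemma negMoment_zero (F : ℝ → ℝ≥0∞) : negMoment F 0 = ∫⁻ x in Ioi 0, F x := by
  simp [negMoment]

lemma negMoment_le_add (F : ℝ → ℝ≥0∞) (hF : Measurable F) {u w : ℝ} (hu : 0 ≤ u) (huw : u ≤ w) :
    negMoment F u ≤ negMoment F 0 + negMoment F w := by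
  rw [negMoment, negMoment, negMoment, ← lintegral_add_left (by fun_prop)]
  refine setLIntegral_mono (by fun_prop) fun x hx => ?_
  have hx : 0 < x := hx
  rw [← add_mul, neg_zero, rpow_zero, ← ENNReal.ofReal_add zero_le_one (by positivity)]
  gcongr
  rcases le_total 1 x with h | h
  · have := rpow_le_one_of_one_le_of_nonpos h (neg_nonpos.2 hu)
    have : 0 < x ^ (-w) := by positivity
    linarith
  · have := rpow_le_rpow_of_exponent_ge hx h (neg_le_neg huw)
    linarith

lemma negMoment_convex_le (F : ℝ → ℝ≥0∞) (hF : Measurable F) {u w a b : ℝ} (ha : 0 < a)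
    (hb : 0 < b) (hab : a + b = 1) :
    negMoment F (a * u + b * w) ≤ negMoment F u ^ a * negMoment F w ^ b := by
  have h := ENNReal.lintegral_mul_norm_pow_le (μ := volume.restrict (Ioi (0 : ℝ)))
    (f := fun x => ENNReal.ofReal (x ^ (-u)) * F x) (g := fun x => ENNReal.ofReal (x ^ (-w)) * F x)
    (by fun_prop) (by fun_prop) ha.le hb.le hab
  refine le_trans (le_of_eq ?_) h
  refine setLIntegral_congr_fun measurableSet_Ioi fun x hx => ?_
  have hx : 0 < x := hx
  rw [ENNReal.mul_rpow_of_nonneg _ _ ha.le, ENNReal.mul_rpow_of_nonneg _ _ hb.le,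
    ENNReal.ofReal_rpow_of_nonneg (by positivity) ha.le,
    ENNReal.ofReal_rpow_of_nonneg (by positivity) hb.le, mul_mul_mul_comm,
    ← ENNReal.ofReal_mul (by positivity), ← ENNReal.rpow_add_of_nonneg _ _ ha.le hb.le, hab,
    ENNReal.rpow_one, ← rpow_mul hx.le, ← rpow_mul hx.le, ← rpow_add hx]
  congr 3
  ring

lemma negMoment_ne_zero (F : ℝ → ℝ≥0∞) (hF : Measurable F) (h : negMoment F 0 ≠ 0) (u : ℝ) :
    negMoment F u ≠ 0 := by
  contrapose! h
  rw [negMoment, lintegral_eq_zero_iff (by fun_prop), EventuallyEq,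
    ae_restrict_iff' measurableSet_Ioi] at h
  rw [negMoment_zero, lintegral_eq_zero_iff hF, EventuallyEq, ae_restrict_iff' measurableSet_Ioi]
  filter_upwards [h] with x hx hx0
  have hx0' : 0 < x := hx0
  have := hx hx0
  simp only [Pi.zero_apply, mul_eq_zero, ENNReal.ofReal_eq_zero, not_le.2 (rpow_pos_of_pos hx0' _),
    false_or] at this
  exact this

/-- Nonnegative solutions, up to null sets, of the fractional equation with unit mass. -/
structure IsFracDensity (α m : ℝ) (F : ℝ → ℝ≥0∞) : Prop where
  measurable : Measurable F
  ae_eq : ∀ᵐ x ∂volume.restrict (Ioi (0 : ℝ)), F x = fracOp α m F x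
  mass : negMoment F 0 = 1

namespace IsFracDensity

variable {α m : ℝ} {F G : ℝ → ℝ≥0∞}

lemma negMoment_eq (hF : IsFracDensity α m F) (hα : 0 < α) {u : ℝ} (hu : 0 < u + (m - α)) :
    negMoment F u = ENNReal.ofReal (Gamma (u + (m - α)) / Gamma (u + (m - α) + α)) *
        negMoment F (u + (m - α)) := by
  rw [negMoment_congr hF.ae_eq, negMoment_fracOp hα hu hF.measurable]

lemma negMoment_ne_top (hF : IsFracDensity α m F) (hα : 0 < α) (hm : α < m) {u : ℝ}
    (hu : 0 < u + (m - α)) : negMoment F u ≠ ∞ := by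
  have hδ : 0 < m - α := by linarith
  have hn (n : ℕ) : negMoment F (n * (m - α)) ≠ ∞ := by
    induction n with
    | zero => simp [hF.mass]
    | succ n ih =>
      have hp : 0 < n * (m - α) + (m - α) := by positivity
      rw [hF.negMoment_eq hα hp] at ih
      push_cast
      rw [add_one_mul]
      have h1 := Gamma_pos_of_pos hp
      have h2 := Gamma_pos_of_pos (s := n * (m - α) + (m - α) + α) (by linarith)
      intro h
      rw [h] at ih
      exact ih (ENNReal.mul_top (ENNReal.ofReal_pos.2 (by positivity)).ne')
  have hnn {w : ℝ} (hw : 0 ≤ w) : negMoment F w ≠ ∞ := by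
    obtain ⟨n, hn'⟩ := exists_nat_gt (w / (m - α))
    refine ne_top_of_le_ne_top ?_
      (negMoment_le_add F hF.measurable hw ((div_lt_iff₀ hδ).1 hn').le)
    exact ENNReal.add_ne_top.2 ⟨by simp [hF.mass], hn n⟩
  rw [hF.negMoment_eq hα hu]
  exact ENNReal.mul_ne_top ENNReal.ofReal_ne_top (hnn hu.le)

lemma negMoment_toReal_pos (hF : IsFracDensity α m F) (hα : 0 < α) (hm : α < m) {u : ℝ}
    (hu : 0 < u + (m - α)) : 0 < (negMoment F u).toReal :=
  ENNReal.toReal_pos (negMoment_ne_zero F hF.measurable (by simp [hF.mass]) u)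
    (hF.negMoment_ne_top hα hm hu)

lemma convexOn_log_negMoment (hF : IsFracDensity α m F) (hα : 0 < α) (hm : α < m) :
    ConvexOn ℝ (Ioi (-(m - α))) fun u => log (negMoment F u).toReal := by
  refine convexOn_iff_forall_pos.2 ⟨convex_Ioi _, fun u hu w hw a b ha hb hab => ?_⟩
  have hu' : 0 < u + (m - α) := by simp at hu ⊢; linarith
  have hw' : 0 < w + (m - α) := by simp at hw ⊢; linarith
  have huw : 0 < a * u + b * w + (m - α) := by
    have : a * u + b * w + (m - α) = a * (u + (m - α)) + b * (w + (m - α)) := by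
      linear_combination (-(m - α)) * hab
    rw [this]; positivity
  have h := negMoment_convex_le F hF.measurable (u := u) (w := w) ha hb hab
  have hU := hF.negMoment_ne_top hα hm hu'
  have hW := hF.negMoment_ne_top hα hm hw'
  have h2 := ENNReal.toReal_mono (ENNReal.mul_ne_top (ENNReal.rpow_ne_top_of_nonneg ha.le hU)
    (ENNReal.rpow_ne_top_of_nonneg hb.le hW)) h
  rw [ENNReal.toReal_mul, ← ENNReal.toReal_rpow, ← ENNReal.toReal_rpow] at h2
  have pU := hF.negMoment_toReal_pos hα hm hu'
  have pW := hF.negMoment_toReal_pos hα hm hw'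
  have h3 := log_le_log (hF.negMoment_toReal_pos hα hm huw) h2
  rw [log_mul (by positivity) (by positivity), log_rpow pU, log_rpow pW] at h3
  simpa using h3

lemma negMoment_unique (hF : IsFracDensity α m F) (hG : IsFracDensity α m G) (hα : 0 < α)
    (hm : α < m) {u : ℝ} (hu : 0 < u + (m - α)) : negMoment F u = negMoment G u := by
  have hδ : 0 < m - α := by linarith
  have key {H : ℝ → ℝ≥0∞} (hH : IsFracDensity α m H) (u : ℝ) (hu : -(m - α) < u) :
      log (negMoment H (u + (m - α))).toReal - log (negMoment H u).toReal =
        log (Gamma (u + (m - α) + α)) - log (Gamma (u + (m - α))) := by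
    have hu' : 0 < u + (m - α) := by linarith
    have h1 := Gamma_pos_of_pos hu'
    have h2 := Gamma_pos_of_pos (s := u + (m - α) + α) (by linarith)
    rw [hH.negMoment_eq hα hu', ENNReal.toReal_mul, ENNReal.toReal_ofReal (by positivity),
      log_mul (by positivity) (hH.negMoment_toReal_pos hα hm (by linarith)).ne',
      log_div h1.ne' h2.ne']
    ring
  have hlim := (tendsto_log_Gamma_ratio_shift hα hδ).comp
    (tendsto_atTop_add_const_right atTop (m - α) tendsto_id)
  have h := (hF.convexOn_log_negMoment hα hm).eqOn_of_shift_sub_eq (by linarith) hδ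
    (hG.convexOn_log_negMoment hα hm) (key hF) (key hG) hlim (by simp [hF.mass, hG.mass])
    (show u ∈ Ioi (-(m - α)) by simp; linarith)
  have h' := log_injOn_pos (hF.negMoment_toReal_pos hα hm hu) (hG.negMoment_toReal_pos hα hm hu) h
  exact (ENNReal.toReal_eq_toReal_iff' (hF.negMoment_ne_top hα hm hu)
    (hG.negMoment_ne_top hα hm hu)).1 h'

end IsFracDensity

lemma MeasureTheory.Measure.ext_of_mgf_id_eqOn {μ ν : Measure ℝ} [IsFiniteMeasure μ]
    [IsFiniteMeasure ν] {r : ℝ} (hr : 0 < r)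
    (hμ : Ioo (-r) r ⊆ ProbabilityTheory.integrableExpSet id μ)
    (hν : Ioo (-r) r ⊆ ProbabilityTheory.integrableExpSet id ν)
    (h : EqOn (ProbabilityTheory.mgf id μ) (ProbabilityTheory.mgf id ν) (Ioo (-r) r)) :
    μ = ν := by
  have hμ' := interior_maximal hμ isOpen_Ioo
  have hν' := interior_maximal hν isOpen_Ioo
  have h0 : (0 : ℝ) ∈ Ioo (-r) r := ⟨by linarith, hr⟩
  have key : EqOn (ProbabilityTheory.complexMGF id μ) (ProbabilityTheory.complexMGF id ν)
      {z | z.re ∈ Ioo (-r) r} := by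
    refine AnalyticOnNhd.eqOn_of_preconnected_of_frequently_eq
      (ProbabilityTheory.analyticOnNhd_complexMGF.mono fun z hz => hμ' hz)
      (ProbabilityTheory.analyticOnNhd_complexMGF.mono fun z hz => hν' hz)
      ((convex_Ioo (-r) r).linear_preimage Complex.reLm).isPreconnected
      (z₀ := ((0 : ℝ) : ℂ)) (by simpa using hr) ?_
    have h_real : ∃ᶠ x : ℝ in 𝓝[≠] 0,
        ProbabilityTheory.complexMGF id μ x = ProbabilityTheory.complexMGF id ν x := by
      refine Eventually.frequently ?_
      filter_upwards [mem_nhdsWithin_of_mem_nhds (Ioo_mem_nhds h0.1 h0.2)] with x hx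
      rw [ProbabilityTheory.complexMGF_ofReal, ProbabilityTheory.complexMGF_ofReal, h hx]
    rw [frequently_iff_seq_forall] at h_real ⊢
    obtain ⟨xs, hx_tendsto, hx_eq⟩ := h_real
    refine ⟨fun n => xs n, ?_, hx_eq⟩
    rw [tendsto_nhdsWithin_iff] at hx_tendsto ⊢
    refine ⟨(Complex.continuous_ofReal.tendsto 0).comp hx_tendsto.1, ?_⟩
    filter_upwards [hx_tendsto.2] with n hn
    simpa using hn
  refine Measure.ext_of_charFun (funext fun t => ?_)
  rw [← ProbabilityTheory.complexMGF_id_mul_I, ← ProbabilityTheory.complexMGF_id_mul_I]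
  exact key (by simpa using hr)

/-- The distribution of `-log X` when `X` has density `F` on `(0, ∞)`. -/
def negLogLaw (F : ℝ → ℝ≥0∞) : Measure ℝ :=
  ((volume.restrict (Ioi 0)).withDensity F).map fun x => -log x

lemma lintegral_exp_negLogLaw {F : ℝ → ℝ≥0∞} (hF : Measurable F) (t : ℝ) :
    ∫⁻ y, ENNReal.ofReal (rexp (t * y)) ∂negLogLaw F = negMoment F t := by
  rw [negLogLaw, lintegral_map (by fun_prop) (by fun_prop),
    lintegral_withDensity_eq_lintegral_mul _ hF (by fun_prop)]
  refine setLIntegral_congr_fun measurableSet_Ioi fun x hx => ?_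
  have hx : 0 < x := hx
  simp only [Pi.mul_apply]
  rw [rpow_def_of_pos hx, mul_comm]
  congr 3
  ring

lemma map_exp_neg_negLogLaw {F : ℝ → ℝ≥0∞} :
    (negLogLaw F).map (fun y => rexp (-y)) = (volume.restrict (Ioi 0)).withDensity F := by
  rw [negLogLaw, Measure.map_map (by fun_prop) (by fun_prop)]
  conv_rhs => rw [← Measure.map_id (μ := (volume.restrict (Ioi 0)).withDensity F)]
  refine Measure.map_congr ?_
  refine (withDensity_absolutelyContinuous _ _).ae_le ?_
  filter_upwards [ae_restrict_mem measurableSet_Ioi] with x hx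
  simp [exp_log (show 0 < x from hx)]

namespace IsFracDensity

variable {α m : ℝ} {F G : ℝ → ℝ≥0∞}

lemma isFiniteMeasure_negLogLaw (hF : IsFracDensity α m F) : IsFiniteMeasure (negLogLaw F) := by
  refine ⟨?_⟩
  have := lintegral_exp_negLogLaw hF.measurable 0
  simp only [zero_mul, exp_zero, ENNReal.ofReal_one, lintegral_one, hF.mass] at this
  simp [this]

lemma integrable_exp_negLogLaw (hF : IsFracDensity α m F) (hα : 0 < α) (hm : α < m) {t : ℝ}
    (ht : 0 < t + (m - α)) : t ∈ ProbabilityTheory.integrableExpSet id (negLogLaw F) := by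
  change Integrable _ _
  refine ⟨by fun_prop, ?_⟩
  rw [hasFiniteIntegral_iff_ofReal (ae_of_all _ fun y => (exp_pos _).le)]
  simp only [id]
  rw [lintegral_exp_negLogLaw hF.measurable]
  exact (hF.negMoment_ne_top hα hm ht).lt_top

lemma mgf_negLogLaw (hF : IsFracDensity α m F) (t : ℝ) :
    ProbabilityTheory.mgf id (negLogLaw F) t = (negMoment F t).toReal := by
  rw [ProbabilityTheory.mgf, integral_eq_lintegral_of_nonneg_ae
    (ae_of_all _ fun y => (exp_pos _).le) (by fun_prop)]
  simp only [id]
  rw [lintegral_exp_negLogLaw hF.measurable]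

/-- Unit-mass solutions of the fractional equation agree almost everywhere. -/
theorem unique (hF : IsFracDensity α m F) (hG : IsFracDensity α m G) (hα : 0 < α) (hm : α < m) :
    ∀ᵐ x ∂volume.restrict (Ioi (0 : ℝ)), F x = G x := by
  have := hF.isFiniteMeasure_negLogLaw
  have := hG.isFiniteMeasure_negLogLaw
  have hpos {t : ℝ} (ht : t ∈ Ioo (-(m - α)) (m - α)) : 0 < t + (m - α) := by linarith [ht.1]
  have h : negLogLaw F = negLogLaw G := by
    refine Measure.ext_of_mgf_id_eqOn (r := m - α) (by linarith) (fun t ht => ?_) (fun t ht => ?_)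
      fun t ht => ?_
    · exact hF.integrable_exp_negLogLaw hα hm (hpos ht)
    · exact hG.integrable_exp_negLogLaw hα hm (hpos ht)
    · rw [hF.mgf_negLogLaw, hG.mgf_negLogLaw, hF.negMoment_unique hG hα hm (hpos ht)]
  have h2 := map_exp_neg_negLogLaw (F := F)
  rw [h, map_exp_neg_negLogLaw] at h2
  refine ((withDensity_eq_iff hG.measurable.aemeasurable hF.measurable.aemeasurable ?_).1 h2).symm
  rw [← negMoment_zero, hG.mass]
  simp

end IsFracDensity

lemma abs_le_mul_pow_succ_of_hasDerivAt {R R' : ℝ → ℝ} {b C : ℝ} {n : ℕ} (hC : 0 ≤ C)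
    (h0 : R 0 = 0) (hR : ∀ t ∈ Icc 0 b, HasDerivAt R (R' t) t)
    (hR' : ∀ t ∈ Icc 0 b, |R' t| ≤ C * t ^ n) {t : ℝ} (ht : t ∈ Icc 0 b) :
    |R t| ≤ C * t ^ (n + 1) := by
  have h := (convex_Icc 0 t).norm_image_sub_le_of_norm_hasDerivWithin_le (f := R) (f' := R')
    (C := C * t ^ n) (x := 0) (y := t)
    (fun x hx => (hR x ⟨hx.1, hx.2.trans ht.2⟩).hasDerivWithinAt)
    (fun x hx => (hR' x ⟨hx.1, hx.2.trans ht.2⟩).trans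
      (mul_le_mul_of_nonneg_left (pow_le_pow_left₀ hx.1 hx.2 n) hC))
    (left_mem_Icc.2 ht.1) (right_mem_Icc.2 ht.1)
  rw [h0, sub_zero, sub_zero, Real.norm_eq_abs, Real.norm_eq_abs, abs_of_nonneg ht.1] at h
  rw [pow_succ, ← mul_assoc]
  exact h

lemma hasDerivAt_one_sub_rpow_neg (b : ℝ) {t : ℝ} (ht : t < 1) :
    HasDerivAt (fun t : ℝ => (1 - t) ^ (-b)) (b * (1 - t) ^ (-(b + 1))) t := by
  have h := ((hasDerivAt_id t).const_sub 1).rpow_const (p := -b) (Or.inl (by simp; linarith))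
  refine h.congr_deriv ?_
  rw [show -b - 1 = -(b + 1) by ring]
  simp

lemma exists_abs_one_sub_rpow_sub_le {β : ℝ} (hβ : 0 < β) :
    ∃ C, 0 ≤ C ∧ ∀ t ∈ Icc (0 : ℝ) (1 / 2),
      |((1 - t) ^ (-β) - 1) / β - (t + (1 + β) * t ^ 2 / 2)| ≤ C * t ^ 3 := by
  refine ⟨(1 + β) * ((β + 2) * 2 ^ (β + 3)), by positivity, fun t ht => ?_⟩
  have hlt {t : ℝ} (ht : t ∈ Icc (0 : ℝ) (1 / 2)) : t < 1 := by linarith [ht.2]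
  have h1 : ∀ t ∈ Icc (0 : ℝ) (1 / 2),
      |(1 - t) ^ (-(β + 2)) - 1| ≤ (β + 2) * 2 ^ (β + 3) * t ^ (0 + 1) := fun t ht => by
    refine abs_le_mul_pow_succ_of_hasDerivAt (R := fun t => (1 - t) ^ (-(β + 2)) - 1)
      (by positivity) (by simp)
      (fun t ht => (hasDerivAt_one_sub_rpow_neg (β + 2) (hlt ht)).sub_const 1) (fun t ht => ?_) ht
    have h2 : (0 : ℝ) < 1 - t := by linarith [hlt ht]
    rw [abs_of_nonneg (by positivity), pow_zero, mul_one, show β + 2 + 1 = β + 3 by ring,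
      rpow_neg h2.le, ← inv_rpow h2.le]
    gcongr
    rw [inv_le_comm₀ h2 two_pos]
    linarith [ht.2]
  have h2 : ∀ t ∈ Icc (0 : ℝ) (1 / 2), |(1 - t) ^ (-(β + 1)) - (1 + (1 + β) * t)| ≤
      (1 + β) * ((β + 2) * 2 ^ (β + 3)) * t ^ (1 + 1) := fun t ht => by
    refine abs_le_mul_pow_succ_of_hasDerivAt
      (R := fun t => (1 - t) ^ (-(β + 1)) - (1 + (1 + β) * t))
      (R' := fun t => (1 + β) * ((1 - t) ^ (-(β + 2)) - 1))
      (by positivity) (by simp) (fun t ht => ?_) (fun t ht => ?_) ht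
    · refine ((hasDerivAt_one_sub_rpow_neg (β + 1) (hlt ht)).sub
        (((hasDerivAt_id t).const_mul (1 + β)).const_add 1)).congr_deriv ?_
      rw [show β + 1 + 1 = β + 2 by ring]
      ring
    · rw [abs_mul, abs_of_pos (by linarith), mul_assoc]
      exact mul_le_mul_of_nonneg_left (h1 t ht) (by linarith)
  refine abs_le_mul_pow_succ_of_hasDerivAt
      (R := fun t => ((1 - t) ^ (-β) - 1) / β - (t + (1 + β) * t ^ 2 / 2))
      (by positivity) (by simp) (fun t ht => ?_) h2 ht
  refine ((((hasDerivAt_one_sub_rpow_neg β (hlt ht)).sub_const 1).div_const β).sub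
    ((hasDerivAt_id t).add
      ((((hasDerivAt_id t).pow 2).const_mul (1 + β)).div_const 2))).congr_deriv ?_
  simp only [id, Nat.cast_ofNat]
  field_simp
  ring

lemma abs_exp_sub_one_sub_le {z M : ℝ} (hz : z ≤ M) : |rexp z - 1 - z| ≤ (rexp M + 3) * z ^ 2 := by
  have hM := exp_pos M
  rcases le_total |z| 1 with h | h
  · refine (abs_exp_sub_one_sub_id_le h).trans ?_
    nlinarith [sq_nonneg z]
  · have h1 : |z| ≤ z ^ 2 := by rw [← sq_abs]; nlinarith
    have h2 : rexp z ≤ rexp M := exp_le_exp.2 hz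
    have := exp_pos z
    have := neg_abs_le z
    have := le_abs_self z
    rw [abs_le]
    constructor <;> nlinarith

lemma le_neg_log_one_sub {t : ℝ} (ht : t < 1) : t ≤ -log (1 - t) := by
  linarith [log_le_sub_one_of_pos (show 0 < 1 - t by linarith)]

lemma one_sub_rpow_neg_eq_exp {t : ℝ} (ht : t < 1) (b : ℝ) :
    (1 - t) ^ (-b) = rexp (b * -log (1 - t)) := by
  rw [rpow_def_of_pos (by linarith)]
  ring_nf

lemma le_one_sub_rpow_sub_div {β t : ℝ} (hβ : 0 < β) (ht : t < 1) :
    t ≤ ((1 - t) ^ (-β) - 1) / β := by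
  rw [le_div_iff₀ hβ, one_sub_rpow_neg_eq_exp ht]
  nlinarith [add_one_le_exp (β * -log (1 - t)), le_neg_log_one_sub ht]

/-- The rescaled ratio `g (x (1 - ε s)) / g x` for `g x = x ^ (-q) exp (-x ^ (-β) / β)`,
where `ε = x ^ β`. -/
def scaledRatio (β q ε s : ℝ) : ℝ :=
  if ε * s < 1 then (1 - ε * s) ^ (-q) * rexp (-(((1 - ε * s) ^ (-β) - 1) / β / ε)) else 0

lemma exists_scaledRatio_head_bound {β q : ℝ} (hβ : 0 < β) (hq : 0 ≤ q) :
    ∃ C, 0 ≤ C ∧ ∀ ε s : ℝ, 0 < ε → 0 < s → ε * s ≤ 1 / 2 →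
      |scaledRatio β q ε s - rexp (-s) * (1 + ε * (q * s - (1 + β) * s ^ 2 / 2))| ≤
        C * ε ^ 2 * (s ^ 2 + s ^ 3 + s ^ 4) * rexp (-(s / 2)) := by
  obtain ⟨D, hD0, hD⟩ := exists_abs_one_sub_rpow_sub_le hβ
  set A := 2 * q + 1 + β + D with hA
  refine ⟨(rexp q + 3) * (2 * A ^ 2) + (2 * q + D), by positivity, fun ε s hε hs hεs => ?_⟩
  have hts : 0 < ε * s := by positivity
  have ht1 : ε * s < 1 := by linarith
  have hlog := abs_log_sub_add_sum_range_le (x := ε * s) (by rw [abs_of_pos hts]; exact ht1) 1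
  have hh := hD (ε * s) ⟨hts.le, hεs⟩
  have hle := le_one_sub_rpow_sub_div hβ ht1
  rw [scaledRatio, if_pos ht1, one_sub_rpow_neg_eq_exp ht1 q]
  set l := -log (1 - ε * s) with hl
  set h := ((1 - ε * s) ^ (-β) - 1) / β with hhdef
  have hl1 : |l - ε * s| ≤ 2 * (ε * s) ^ 2 := by
    rw [abs_sub_comm]
    simp only [Finset.range_one, Finset.sum_singleton, Nat.cast_zero, zero_add, pow_one,
      div_one, abs_of_pos hts] at hlog
    rw [hl, sub_neg_eq_add]
    refine hlog.trans ?_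
    rw [div_le_iff₀ (by linarith)]
    norm_num
    nlinarith [mul_le_mul_of_nonneg_left (show 1 / 2 ≤ 1 - ε * s by linarith)
      (sq_nonneg (ε * s))]
  have hl2 : l ≤ 1 := by
    have := (abs_le.1 hl1).2
    nlinarith
  set z := q * l - (h / ε - s) with hz
  set w := ε * (q * s - (1 + β) * s ^ 2 / 2) with hw
  have hzM : z ≤ q := by
    have : s ≤ h / ε := by rw [le_div_iff₀ hε]; linarith
    nlinarith
  have hR : |z - w| ≤ (2 * q + D) * ε ^ 2 * (s ^ 2 + s ^ 3) := by
    have e : z - w = q * (l - ε * s) -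
        (h - (ε * s + (1 + β) * (ε * s) ^ 2 / 2)) / ε := by
      rw [hz, hw]; field_simp; ring
    have h2 : |(h - (ε * s + (1 + β) * (ε * s) ^ 2 / 2)) / ε| ≤ D * ε ^ 2 * s ^ 3 := by
      rw [abs_div, abs_of_pos hε, div_le_iff₀ hε]
      exact hh.trans (le_of_eq (by ring))
    rw [e]
    refine (abs_sub _ _).trans ?_
    rw [abs_mul, abs_of_nonneg hq]
    have h3 : q * |l - ε * s| ≤ q * (2 * (ε * s) ^ 2) := mul_le_mul_of_nonneg_left hl1 hq
    have h4 : 0 ≤ q * ε ^ 2 * s ^ 3 := by positivity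
    have h5 : 0 ≤ D * ε ^ 2 * s ^ 2 := by positivity
    nlinarith
  have hw' : |w| ≤ ε * (q * s + (1 + β) * s ^ 2 / 2) := by
    rw [hw, abs_mul, abs_of_pos hε]
    refine mul_le_mul_of_nonneg_left ((abs_sub _ _).trans ?_) hε.le
    rw [abs_of_nonneg (by positivity), abs_of_nonneg (by positivity)]
  have hz2 : |z| ≤ A * ε * (s + s ^ 2) := by
    have h1 : |z| ≤ |z - w| + |w| := by simpa using abs_add_le (z - w) w
    have h2 : (2 * q + D) * ε ^ 2 * (s ^ 2 + s ^ 3) ≤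
        (2 * q + D) * ε * (1 / 2) * (s + s ^ 2) := by
      have : 0 ≤ (2 * q + D) * ε * (s + s ^ 2) := by positivity
      nlinarith
    have p1 : 0 ≤ ε * s := hts.le
    have p2 : 0 ≤ ε * s ^ 2 := by positivity
    have p3 := mul_nonneg hq p1
    have p4 := mul_nonneg hq p2
    have p5 := mul_nonneg hD0 p1
    have p6 := mul_nonneg hD0 p2
    have p7 := mul_nonneg hβ.le p1
    have p8 := mul_nonneg hβ.le p2
    rw [hA]
    nlinarith
  have hzsq : z ^ 2 ≤ 2 * A ^ 2 * ε ^ 2 * (s ^ 2 + s ^ 4) := by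
    rw [← sq_abs]
    refine (pow_le_pow_left₀ (abs_nonneg z) hz2 2).trans ?_
    have : 0 ≤ A ^ 2 * ε ^ 2 * (s - s ^ 2) ^ 2 := by positivity
    nlinarith
  have hexp := abs_exp_sub_one_sub_le hzM
  have e1 : rexp (q * l) * rexp (-(h / ε)) = rexp (-s) * rexp z := by
    rw [← exp_add, ← exp_add]; congr 1; rw [hz]; ring
  rw [e1, ← mul_sub, abs_mul, abs_of_pos (exp_pos _), mul_comm]
  have hes : rexp (-s) ≤ rexp (-(s / 2)) := exp_le_exp.2 (by linarith)
  refine mul_le_mul ?_ hes (exp_pos _).le (by positivity)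
  have e2 : rexp z - (1 + w) = (rexp z - 1 - z) + (z - w) := by ring
  rw [e2]
  refine (abs_add_le _ _).trans ((add_le_add hexp hR).trans ?_)
  have hE := exp_pos q
  have h1 : (rexp q + 3) * z ^ 2 ≤ (rexp q + 3) * (2 * A ^ 2 * ε ^ 2 * (s ^ 2 + s ^ 4)) :=
    mul_le_mul_of_nonneg_left hzsq (by positivity)
  have h2 : 0 ≤ (rexp q + 3) * (2 * A ^ 2 * ε ^ 2 * s ^ 3) := by positivity
  have h3 : 0 ≤ (2 * q + D) * ε ^ 2 * s ^ 4 := by positivity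
  linarith

lemma exists_scaledRatio_le {β q : ℝ} (hβ : 0 < β) (hq : 0 ≤ q) :
    ∃ C, 0 ≤ C ∧ ∀ ε s : ℝ, 0 < ε → ε ≤ 1 → 0 < s → |scaledRatio β q ε s| ≤ C * rexp (-(s / 2)) := by
  set a := q / β with ha
  set b := 1 / (2 * β) with hb
  have hb0 : 0 < b := by positivity
  refine ⟨(a / b) ^ a * rexp b, by positivity, fun ε s hε hε1 hs => ?_⟩
  rw [scaledRatio]
  split_ifs with h
  · have h1 : 0 < 1 - ε * s := by linarith
    set r := (1 - ε * s) ^ (-β) with hr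
    have hr0 : 0 < r := by positivity
    have hle := le_one_sub_rpow_sub_div hβ h
    rw [← hr] at hle
    have hrq : (1 - ε * s) ^ (-q) = r ^ a := by
      rw [hr, ← rpow_mul h1.le, ha]
      congr 1
      field_simp
    have hra : r ^ a ≤ (a / b) ^ a * rexp (b * r) := by
      have := ProbabilityTheory.rpow_abs_le_mul_max_exp_of_pos r (p := a) (t := b)
        (by positivity) hb0
      rwa [abs_of_pos hr0, max_eq_left (exp_le_exp.2 (by nlinarith [mul_pos hb0 hr0]))] at this
    have hexp : -((r - 1) / β / ε) ≤ -(s / 2) - b * r + b := by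
      have h2 : s ≤ (r - 1) / β / ε := by rw [le_div_iff₀ hε]; linarith
      have h3 : (r - 1) / β ≤ (r - 1) / β / ε := by
        rw [le_div_iff₀ hε]
        have : 0 ≤ (r - 1) / β := le_trans (by positivity) hle
        nlinarith
      have h4 : (r - 1) / β = 2 * (b * r - b) := by rw [hb]; field_simp
      linarith
    rw [abs_of_nonneg (by positivity), hrq]
    calc r ^ a * rexp (-((r - 1) / β / ε))
        ≤ (a / b) ^ a * rexp (b * r) * rexp (-(s / 2) - b * r + b) := by gcongr
      _ = _ := by
        rw [mul_assoc, mul_assoc, ← exp_add, ← exp_add]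
        congr 2
        ring
  · rw [abs_zero]; positivity

lemma exists_scaledRatio_bound {β q : ℝ} (hβ : 0 < β) (hq : 0 ≤ q) :
    ∃ C, 0 ≤ C ∧ ∀ ε s : ℝ, 0 < ε → ε ≤ 1 → 0 < s →
      |scaledRatio β q ε s - rexp (-s) * (1 + ε * (q * s - (1 + β) * s ^ 2 / 2))| ≤
        C * ε ^ 2 * (s ^ 2 + s ^ 3 + s ^ 4) * rexp (-(s / 2)) := by
  obtain ⟨C₁, hC₁, h₁⟩ := exists_scaledRatio_head_bound hβ hq
  obtain ⟨C₂, hC₂, h₂⟩ := exists_scaledRatio_le hβ hq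
  refine ⟨C₁ + (4 * C₂ + 4 + 2 * q + (1 + β)), by positivity, fun ε s hε hε1 hs => ?_⟩
  rcases le_or_gt (ε * s) (1 / 2) with h | h
  · refine (h₁ ε s hε hs h).trans ?_
    gcongr
    linarith [show 0 ≤ 4 * C₂ + 4 + 2 * q + (1 + β) by positivity]
  · have hes : rexp (-s) ≤ rexp (-(s / 2)) := exp_le_exp.2 (by linarith)
    have hx : |1 + ε * (q * s - (1 + β) * s ^ 2 / 2)| ≤
        1 + ε * (q * s + (1 + β) * s ^ 2 / 2) := by
      have : 0 ≤ ε * (q * s) := by positivity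
      have : 0 ≤ ε * ((1 + β) * s ^ 2 / 2) := by positivity
      rw [abs_le]
      constructor <;> nlinarith
    have hmain : |rexp (-s) * (1 + ε * (q * s - (1 + β) * s ^ 2 / 2))| ≤
        rexp (-(s / 2)) * (1 + ε * (q * s + (1 + β) * s ^ 2 / 2)) := by
      rw [abs_mul, abs_of_pos (exp_pos _)]
      exact mul_le_mul hes hx (abs_nonneg _) (exp_pos _).le
    have hpoly : C₂ + (1 + ε * (q * s + (1 + β) * s ^ 2 / 2)) ≤
        (C₁ + (4 * C₂ + 4 + 2 * q + (1 + β))) * ε ^ 2 * (s ^ 2 + s ^ 3 + s ^ 4) := by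
      have a1 : 1 ≤ 4 * (ε ^ 2 * s ^ 2) := by nlinarith
      have a2 : ε * s ≤ 2 * (ε ^ 2 * s ^ 2) := by nlinarith
      have a3 : ε * s ^ 2 ≤ 2 * (ε ^ 2 * s ^ 3) := by
        have := mul_le_mul_of_nonneg_right a2 hs.le
        linarith
      have b1 := mul_le_mul_of_nonneg_left a1 hC₂
      have b2 := mul_le_mul_of_nonneg_left a2 hq
      have b3 := mul_le_mul_of_nonneg_left a3 (show 0 ≤ 1 + β by positivity)
      have c1 : 0 ≤ (C₁ + (4 * C₂ + 4 + 2 * q + (1 + β))) * ε ^ 2 * s ^ 4 := by positivity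
      have c2 : 0 ≤ (C₁ + (4 * C₂ + 4 + 2 * q)) * ε ^ 2 * s ^ 3 := by positivity
      have c3 : 0 ≤ (C₁ + (1 + β)) * ε ^ 2 * s ^ 2 := by positivity
      linarith
    calc _ ≤ |scaledRatio β q ε s| + |rexp (-s) * (1 + ε * (q * s - (1 + β) * s ^ 2 / 2))| :=
          abs_sub _ _
      _ ≤ C₂ * rexp (-(s / 2)) + rexp (-(s / 2)) * (1 + ε * (q * s + (1 + β) * s ^ 2 / 2)) :=
          add_le_add (h₂ ε s hε hε1 hs) hmain
      _ = (C₂ + (1 + ε * (q * s + (1 + β) * s ^ 2 / 2))) * rexp (-(s / 2)) := by ring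
      _ ≤ _ := mul_le_mul_of_nonneg_right hpoly (exp_pos _).le

lemma measurable_scaledRatio (β q ε : ℝ) : Measurable (scaledRatio β q ε) :=
  Measurable.ite (measurableSet_lt (by fun_prop) measurable_const) (by fun_prop) measurable_const

lemma scaledRatio_nonneg (β q ε s : ℝ) : 0 ≤ scaledRatio β q ε s := by
  rw [scaledRatio]
  split_ifs with h
  · have : 0 < 1 - ε * s := by linarith
    positivity
  · exact le_rfl

lemma integrableOn_rpow_mul_exp_neg_half {a : ℝ} (ha : -1 < a) :
    IntegrableOn (fun s : ℝ => s ^ a * rexp (-(s / 2))) (Ioi 0) := by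
  have h := integrableOn_rpow_mul_exp_neg_mul_rpow (p := 1) (s := a) (b := 1 / 2) ha one_pos
    (by norm_num)
  refine h.congr_fun (fun s hs => ?_) measurableSet_Ioi
  simp only [rpow_one]
  ring_nf

lemma exists_integral_scaledRatio_bound {α β q : ℝ} (hα : 0 < α) (hβ : 0 < β) (hq : 0 ≤ q) :
    ∃ K, 0 ≤ K ∧ ∀ ε : ℝ, 0 < ε → ε ≤ 1 →
      IntegrableOn (fun s => s ^ (α - 1) * scaledRatio β q ε s) (Ioi 0) ∧
      |(∫ s in Ioi 0, s ^ (α - 1) * scaledRatio β q ε s) / Gamma α -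
        (1 + ε * (α * (q - (1 + β) * (1 + α) / 2)))| ≤ K * ε ^ 2 := by
  obtain ⟨C, hC0, hC⟩ := exists_scaledRatio_bound hβ hq
  have hΓ := Gamma_pos_of_pos hα
  set B : ℝ → ℝ := fun s => s ^ (α + 1) * rexp (-(s / 2)) + s ^ (α + 2) * rexp (-(s / 2)) +
    s ^ (α + 3) * rexp (-(s / 2)) with hB
  have hBint : IntegrableOn B (Ioi 0) :=
    ((integrableOn_rpow_mul_exp_neg_half (by linarith)).add
      (integrableOn_rpow_mul_exp_neg_half (by linarith))).add
      (integrableOn_rpow_mul_exp_neg_half (by linarith))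
  have hBnn : 0 ≤ ∫ s in Ioi 0, B s := setIntegral_nonneg measurableSet_Ioi fun s hs => by
    have : 0 < s := hs
    positivity
  refine ⟨C * (∫ s in Ioi 0, B s) / Gamma α, by positivity, fun ε hε hε1 => ?_⟩
  have g0 := GammaIntegral_convergent hα
  have g1 := GammaIntegral_convergent (s := α + 1) (by linarith)
  have g2 := GammaIntegral_convergent (s := α + 1 + 1) (by linarith)
  set L : ℝ → ℝ := fun s => rexp (-s) * s ^ (α - 1) + (ε * q * (rexp (-s) * s ^ (α + 1 - 1)) -
    ε * ((1 + β) / 2) * (rexp (-s) * s ^ (α + 1 + 1 - 1))) with hL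
  have hLint : IntegrableOn L (Ioi 0) :=
    g0.add ((g1.const_mul (ε * q)).sub (g2.const_mul (ε * ((1 + β) / 2))))
  have hLval : ∫ s in Ioi 0, L s =
      Gamma α * (1 + ε * (α * (q - (1 + β) * (1 + α) / 2))) := by
    have h12 := (g1.const_mul (ε * q)).sub (g2.const_mul (ε * ((1 + β) / 2)))
    have e := integral_add g0 h12
    have e' := integral_sub (g1.const_mul (ε * q)) (g2.const_mul (ε * ((1 + β) / 2)))
    rw [integral_const_mul, integral_const_mul, ← Gamma_eq_integral (by linarith),
      ← Gamma_eq_integral (by linarith), Gamma_add_one (show α + 1 ≠ 0 by linarith),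
      Gamma_add_one hα.ne'] at e'
    rw [← Gamma_eq_integral hα] at e
    refine e.trans ?_
    erw [e']
    ring
  have hbound : ∀ s ∈ Ioi (0 : ℝ),
      ‖s ^ (α - 1) * scaledRatio β q ε s - L s‖ ≤ C * ε ^ 2 * B s := by
    intro s hs
    have hs : 0 < s := hs
    have e1 : s ^ (α - 1) * scaledRatio β q ε s - L s = s ^ (α - 1) *
        (scaledRatio β q ε s - rexp (-s) * (1 + ε * (q * s - (1 + β) * s ^ 2 / 2))) := by
      simp only [hL]
      have r1 : s ^ (α + 1 - 1) = s ^ (α - 1) * s := by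
        rw [← rpow_add_one hs.ne']; ring_nf
      have r2 : s ^ (α + 1 + 1 - 1) = s ^ (α - 1) * s * s := by
        rw [← rpow_add_one hs.ne', ← rpow_add_one hs.ne']; ring_nf
      rw [r1, r2]
      ring
    rw [e1, norm_mul, Real.norm_eq_abs, Real.norm_eq_abs, abs_of_pos (rpow_pos_of_pos hs _)]
    refine (mul_le_mul_of_nonneg_left (hC ε s hε hε1 hs) (by positivity)).trans (le_of_eq ?_)
    simp only [hB]
    rw [show α + 1 = α - 1 + (2 : ℕ) by push_cast; ring,
      show α + 2 = α - 1 + (3 : ℕ) by push_cast; ring,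
      show α + 3 = α - 1 + (4 : ℕ) by push_cast; ring,
      rpow_add_natCast hs.ne', rpow_add_natCast hs.ne', rpow_add_natCast hs.ne']
    ring
  have hmeas := measurable_scaledRatio β q ε
  have hdiff : IntegrableOn (fun s => s ^ (α - 1) * scaledRatio β q ε s - L s) (Ioi 0) := by
    refine Integrable.mono' (hBint.const_mul (C * ε ^ 2)) ?_
      ((ae_restrict_iff' measurableSet_Ioi).2 (ae_of_all _ hbound))
    exact (Measurable.aestronglyMeasurable (by fun_prop)).sub hLint.aestronglyMeasurable
  have hint : IntegrableOn (fun s => s ^ (α - 1) * scaledRatio β q ε s) (Ioi 0) := by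
    refine (hdiff.add hLint).congr_fun (fun s _ => ?_) measurableSet_Ioi
    simp
  refine ⟨hint, ?_⟩
  have hI := norm_integral_le_of_norm_le (hBint.const_mul (C * ε ^ 2))
    ((ae_restrict_iff' measurableSet_Ioi).2 (ae_of_all _ hbound))
  rw [integral_sub hint hLint, hLval, integral_const_mul, Real.norm_eq_abs] at hI
  rw [div_sub' hΓ.ne', abs_div, abs_of_pos hΓ, div_le_iff₀ hΓ]
  refine hI.trans (le_of_eq ?_)
  field_simp

/-- The second-order WKB profile `x ^ (-q) exp (-x ^ (-β) / β)`. -/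
def wkb (β q x : ℝ) : ℝ := x ^ (-q) * rexp (-(x ^ (-β) / β))

lemma wkb_pos (β q : ℝ) {x : ℝ} (hx : 0 < x) : 0 < wkb β q x := by
  rw [wkb]; positivity

lemma measurable_wkb (β q : ℝ) : Measurable (wkb β q) := by
  unfold wkb; fun_prop

lemma wkb_sub (β q η : ℝ) {x : ℝ} (hx : 0 < x) : wkb β (q - η) x = wkb β q x * x ^ η := by
  rw [wkb, wkb, neg_sub, sub_eq_neg_add, rpow_add hx]
  ring

lemma image_sub_mul_Ioo {x c : ℝ} (hc : 0 < c) :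
    (fun s => x - c * s) '' Ioo 0 (x / c) = Ioo 0 x := by
  ext v
  constructor
  · rintro ⟨s, ⟨h0, h1⟩, rfl⟩
    rw [lt_div_iff₀ hc] at h1
    exact ⟨by linarith, by nlinarith⟩
  · rintro ⟨h0, h1⟩
    refine ⟨(x - v) / c, ⟨div_pos (by linarith) hc, by gcongr; linarith⟩, ?_⟩
    field_simp
    ring

lemma wkb_sub_mul_eq {β q x s : ℝ} (hx : 0 < x) (hs : x ^ β * s < 1) :
    wkb β q (x - x ^ (1 + β) * s) = wkb β q x * scaledRatio β q (x ^ β) s := by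
  have h1 : 0 < 1 - x ^ β * s := by linarith
  have e : x - x ^ (1 + β) * s = x * (1 - x ^ β * s) := by
    rw [rpow_add hx, rpow_one]; ring
  rw [scaledRatio, if_pos hs, wkb, wkb, e, mul_rpow hx.le h1.le, mul_rpow hx.le h1.le,
    mul_mul_mul_comm, ← exp_add]
  congr 2
  rw [rpow_neg hx.le β]
  field_simp
  ring

lemma fracOp_wkb {α m q x : ℝ} (hα : 0 < α) (hx : 0 < x)
    (hint : IntegrableOn (fun s => s ^ (α - 1) * scaledRatio ((m - α) / α) q (x ^ ((m - α) / α)) s)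
      (Ioi 0)) :
    fracOp α m (fun v => ENNReal.ofReal (wkb ((m - α) / α) q v)) x =
      ENNReal.ofReal (wkb ((m - α) / α) q x * ((∫ s in Ioi 0,
        s ^ (α - 1) * scaledRatio ((m - α) / α) q (x ^ ((m - α) / α)) s) / Gamma α)) := by
  set β := (m - α) / α with hβ
  have hm : m = α * (1 + β) := by rw [hβ]; field_simp; ring
  have hΓ := Gamma_pos_of_pos hα
  have hc : 0 < x ^ (1 + β) := by positivity
  have hxc : x / x ^ (1 + β) = (x ^ β)⁻¹ := by
    rw [rpow_add hx, rpow_one]; field_simp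
  have hw := wkb_pos β q hx
  have key : ∀ s ∈ Ioo 0 (x / x ^ (1 + β)), ENNReal.ofReal |-x ^ (1 + β)| *
      (ENNReal.ofReal ((x - (x - x ^ (1 + β) * s)) ^ (α - 1) / (Gamma α * x ^ m)) *
        ENNReal.ofReal (wkb β q (x - x ^ (1 + β) * s))) =
      ENNReal.ofReal (wkb β q x / Gamma α) *
        ENNReal.ofReal (s ^ (α - 1) * scaledRatio β q (x ^ β) s) := by
    rintro s ⟨h0, h1⟩
    have hs : x ^ β * s < 1 := by
      rw [hxc, lt_inv_comm₀ h0 (by positivity)] at h1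
      rwa [← lt_inv_mul_iff₀' h0, mul_one] 
    rw [wkb_sub_mul_eq hx hs, sub_sub_cancel, abs_neg, abs_of_pos hc,
      ← ENNReal.ofReal_mul (by positivity), ← ENNReal.ofReal_mul (by positivity),
      ← ENNReal.ofReal_mul (by positivity)]
    congr 1
    have e : x ^ m = x ^ (1 + β) * (x ^ (1 + β)) ^ (α - 1) := by
      rw [← rpow_mul hx.le, ← rpow_add hx, hm]
      ring_nf
    rw [mul_rpow hc.le h0.le, e]
    field_simp
  rw [fracOp_eq, ← image_sub_mul_Ioo hc, lintegral_image_eq_lintegral_abs_deriv_mul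
    (f' := fun _ => -x ^ (1 + β)) measurableSet_Ioo]
  · have hcut : ∫⁻ s in Ioo 0 (x / x ^ (1 + β)),
        ENNReal.ofReal (s ^ (α - 1) * scaledRatio β q (x ^ β) s) =
        ∫⁻ s in Ioi 0, ENNReal.ofReal (s ^ (α - 1) * scaledRatio β q (x ^ β) s) := by
      rw [← lintegral_indicator measurableSet_Ioo, ← lintegral_indicator measurableSet_Ioi]
      refine lintegral_congr fun s => ?_
      by_cases hs : s ∈ Ioo 0 (x / x ^ (1 + β))
      · rw [indicator_of_mem hs, indicator_of_mem (show s ∈ Ioi 0 from hs.1)]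
      · rw [indicator_of_notMem hs]
        by_cases h0 : 0 < s
        · rw [indicator_of_mem (show s ∈ Ioi 0 from h0), scaledRatio, if_neg, mul_zero,
            ENNReal.ofReal_zero]
          intro h
          refine hs ⟨h0, ?_⟩
          rw [hxc]
          exact (lt_inv_mul_iff₀ (by positivity)).2 h |>.trans_eq (mul_one _)
        · rw [indicator_of_notMem (show s ∉ Ioi 0 from h0)]
    rw [setLIntegral_congr_fun measurableSet_Ioo key,
      lintegral_const_mul' _ _ ENNReal.ofReal_ne_top, hcut,
      ← ofReal_integral_eq_lintegral_ofReal hint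
        ((ae_restrict_iff' measurableSet_Ioi).2 (ae_of_all _ fun s hs =>
          mul_nonneg (rpow_nonneg (le_of_lt hs) _) (scaledRatio_nonneg _ _ _ _))),
      ← ENNReal.ofReal_mul (by positivity)]
    congr 1
    ring
  · intro s hs
    simpa using (((hasDerivAt_id s).const_mul (x ^ (1 + β))).const_sub x).hasDerivWithinAt
  · intro s _ t _ h
    simpa [hc.ne'] using h

lemma exists_fracOp_wkb_bound {α m q : ℝ} (hα : 0 < α) (hm : α < m) (hq : 0 ≤ q) :
    ∃ K, 0 ≤ K ∧ ∀ x : ℝ, 0 < x → x ≤ 1 → ∃ Φ, 0 ≤ Φ ∧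
      |Φ - (1 + x ^ ((m - α) / α) * (α * (q - (1 + (m - α) / α) * (1 + α) / 2)))| ≤
        K * (x ^ ((m - α) / α)) ^ 2 ∧
      fracOp α m (fun v => ENNReal.ofReal (wkb ((m - α) / α) q v)) x =
        ENNReal.ofReal (wkb ((m - α) / α) q x * Φ) := by
  have hβ : 0 < (m - α) / α := div_pos (by linarith) hα
  obtain ⟨K, hK, h⟩ := exists_integral_scaledRatio_bound hα hβ hq
  refine ⟨K, hK, fun x hx hx1 => ?_⟩
  obtain ⟨h1, h2⟩ := h _ (rpow_pos_of_pos hx ((m - α) / α)) (rpow_le_one hx.le hx1 hβ.le)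
  refine ⟨_, div_nonneg (setIntegral_nonneg measurableSet_Ioi fun s hs => ?_)
    (Gamma_pos_of_pos hα).le, h2, fracOp_wkb hα hx h1⟩
  exact mul_nonneg (rpow_nonneg (le_of_lt hs) _) (scaledRatio_nonneg _ _ _ _)

lemma fracOp_add (α m : ℝ) {F G : ℝ → ℝ≥0∞} (hF : Measurable F) (x : ℝ) :
    fracOp α m (fun v => F v + G v) x = fracOp α m F x + fracOp α m G x := by
  simp only [fracOp, mul_add]
  exact lintegral_add_left (((measurable_fracKernel α m).comp measurable_prodMk_left).mul hF) _

lemma fracOp_congr {α m x : ℝ} {F G : ℝ → ℝ≥0∞} (h : ∀ v ∈ Ioo 0 x, F v = G v) :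
    fracOp α m F x = fracOp α m G x :=
  le_antisymm (fracOp_mono fun v hv => (h v hv).le) (fracOp_mono fun v hv => (h v hv).ge)

/-- The functions `(1 ± x ^ η) wkb β p x` are super- and subsolutions of the fractional equation
near zero. -/
lemma exists_barriers {α m : ℝ} (hα : 0 < α) (hm : α < m) :
    ∃ β p η : ℝ, β = (m - α) / α ∧ p = m * (1 + α) / (2 * α) ∧ 0 < η ∧ ∃ x₀, 0 < x₀ ∧ x₀ < 1 ∧
      ∀ x ∈ Ioo 0 x₀, x ^ η ≤ 1 ∧
        fracOp α m (fun v => ENNReal.ofReal (wkb β p v * (1 + v ^ η))) x ≤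
          ENNReal.ofReal (wkb β p x * (1 + x ^ η)) ∧
        ENNReal.ofReal (wkb β p x * (1 - x ^ η)) ≤
          fracOp α m (fun v => ENNReal.ofReal (wkb β p v * (1 - v ^ η))) x := by
  obtain ⟨β, hβ⟩ : ∃ β, β = (m - α) / α := ⟨_, rfl⟩
  have hβ0 : 0 < β := by rw [hβ]; exact div_pos (by linarith) hα
  have hmβ : m = α * (1 + β) := by rw [hβ]; field_simp; ring
  obtain ⟨p, hp⟩ : ∃ p, p = (1 + β) * (1 + α) / 2 := ⟨_, rfl⟩
  obtain ⟨η, hη⟩ : ∃ η, η = β / 2 := ⟨_, rfl⟩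
  have hη0 : 0 < η := by linarith
  have hpη : 0 ≤ p - η := by rw [hp, hη]; nlinarith [mul_pos hβ0 hα]
  obtain ⟨K, hK, hΦ⟩ := exists_fracOp_wkb_bound hα hm (q := p) (by linarith)
  obtain ⟨K', hK', hΨ⟩ := exists_fracOp_wkb_bound hα hm hpη
  rw [← hβ, ← hp] at hΦ hΨ
  set t := min (1 / 2) (α * η / (K + K' + 1)) with ht
  have ht0 : 0 < t := lt_min (by norm_num) (by positivity)
  have ht1 : t < 1 := (min_le_left _ _).trans_lt (by norm_num)
  have htK : (K + K') * t ≤ α * η := by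
    have h : t ≤ α * η / (K + K' + 1) := min_le_right _ _
    rw [le_div_iff₀ (by positivity)] at h
    nlinarith
  refine ⟨β, p, η, hβ, ?_, hη0, t ^ (1 / η), by positivity,
    rpow_lt_one ht0.le ht1 (by positivity), fun x hx => ?_⟩
  · rw [hp, hmβ]; field_simp
  have hx0 : 0 < x := hx.1
  have hxt {v : ℝ} (hv : 0 < v) (h : v < t ^ (1 / η)) : v ^ η < t := by
    have := rpow_lt_rpow hv.le h hη0
    rwa [← rpow_mul ht0.le, one_div_mul_cancel hη0.ne', rpow_one] at this
  have hx1 : x ≤ 1 := (hx.2.trans (rpow_lt_one ht0.le ht1 (by positivity))).le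
  obtain ⟨Φ, hΦ0, hΦ1, hΦ2⟩ := hΦ x hx0 hx1
  obtain ⟨Ψ, hΨ0, hΨ1, hΨ2⟩ := hΨ x hx0 hx1
  have het := hxt hx0 hx.2
  have he0 : 0 < x ^ η := by positivity
  have hε : x ^ β = (x ^ η) ^ 2 := by
    rw [← rpow_natCast, ← rpow_mul hx0.le, hη]; push_cast; ring_nf
  rw [hε] at hΦ1 hΨ1
  obtain ⟨e, he⟩ : ∃ e, e = x ^ η := ⟨_, rfl⟩
  rw [← he] at het he0 hΦ1 hΨ1 ⊢
  have he1 : e ≤ 1 := het.le.trans ht1.le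
  have hw := wkb_pos β p hx0
  have hw' : wkb β (p - η) x = wkb β p x * e := by rw [wkb_sub β p η hx0, he]
  rw [sub_self, mul_zero, mul_zero, add_zero, abs_le] at hΦ1
  rw [abs_le] at hΨ1
  have hsmall : K * e ^ 4 + K' * e ^ 5 ≤ α * η * e ^ 3 := by
    have h1 : (K + K' * e) * e ≤ α * η := by
      calc (K + K' * e) * e ≤ (K + K' * 1) * t := by gcongr
        _ ≤ α * η := by rw [mul_one]; exact htK
    nlinarith [pow_pos he0 3]
  have hup : Φ + e * Ψ ≤ 1 + e := by
    have := mul_le_mul_of_nonneg_left hΨ1.2 he0.le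
    nlinarith
  have hlow : 1 - e + e * Ψ ≤ Φ := by
    have := mul_le_mul_of_nonneg_left hΨ1.2 he0.le
    nlinarith
  have hmeas := (measurable_wkb β p).ennreal_ofReal
  refine ⟨he1, ?_, ?_⟩
  · rw [fracOp_congr (G := fun v => ENNReal.ofReal (wkb β p v) +
      ENNReal.ofReal (wkb β (p - η) v)), fracOp_add α m hmeas, hΦ2, hΨ2, hw',
      ← ENNReal.ofReal_add (by positivity) (by positivity)]
    · refine ENNReal.ofReal_le_ofReal ?_
      calc _ = wkb β p x * (Φ + e * Ψ) := by ring
        _ ≤ _ := mul_le_mul_of_nonneg_left hup hw.le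
    · intro v hv
      rw [← ENNReal.ofReal_add (wkb_pos _ _ hv.1).le (wkb_pos _ _ hv.1).le, wkb_sub β p η hv.1]
      ring_nf
  · have hsum : fracOp α m (fun v => ENNReal.ofReal (wkb β p v * (1 - v ^ η))) x +
        ENNReal.ofReal (wkb β p x * e * Ψ) = ENNReal.ofReal (wkb β p x * Φ) := by
      rw [← hw', ← hΨ2, ← hΦ2, ← fracOp_add]
      · refine fracOp_congr fun v hv => ?_
        have hvt := hxt hv.1 (hv.2.trans hx.2)
        have := wkb_pos β p hv.1
        rw [← ENNReal.ofReal_add (mul_nonneg this.le (by linarith)) (wkb_pos _ _ hv.1).le,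
          wkb_sub β p η hv.1]
        ring_nf
      · have := measurable_wkb β p
        fun_prop
    refine ENNReal.le_of_add_le_add_right (a := ENNReal.ofReal (wkb β p x * e * Ψ))
      ENNReal.ofReal_ne_top ?_
    rw [hsum, ← ENNReal.ofReal_add (mul_nonneg hw.le (by linarith)) (by positivity)]
    refine ENNReal.ofReal_le_ofReal ?_
    calc _ = wkb β p x * (1 - e + e * Ψ) := by ring
      _ ≤ _ := mul_le_mul_of_nonneg_left hlow hw.le

/-- Monotone iteration between a subsolution and a local supersolution. -/
lemma exists_fracOp_fixedPoint {α m x₀ : ℝ} {L U : ℝ → ℝ≥0∞} (hL : Measurable L)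
    (hL1 : ∀ x, L x ≤ fracOp α m L x) (hU : ∀ x ∈ Ioo 0 x₀, fracOp α m U x ≤ U x)
    (hLU : ∀ x ∈ Ioo 0 x₀, L x ≤ U x) :
    ∃ F : ℕ → ℝ → ℝ≥0∞, (∀ n, Measurable (F n)) ∧ Monotone F ∧ F 0 = L ∧
      (∀ n, F (n + 1) = fracOp α m (F n)) ∧ ∀ n, ∀ x ∈ Ioo 0 x₀, F n x ≤ U x := by
  refine ⟨fun n => (fracOp α m)^[n] L, fun n => ?_, monotone_nat_of_le_succ fun n => ?_, rfl,
    fun n => Function.iterate_succ_apply' _ _ _, fun n => ?_⟩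
  · induction n with
    | zero => exact hL
    | succ n ih =>
      simp only [Function.iterate_succ_apply']
      exact measurable_fracOp α m ih
  · induction n with
    | zero => exact hL1
    | succ n ih =>
      simp only [Function.iterate_succ_apply'] at ih ⊢
      exact fun x => fracOp_mono fun v _ => ih v
  · induction n with
    | zero => exact hLU
    | succ n ih =>
      intro x hx
      simp only [Function.iterate_succ_apply']
      exact (fracOp_mono fun v hv => ih v ⟨hv.1, hv.2.trans hx.2⟩).trans (hU x hx)

lemma negMoment_add_le {F U : ℝ → ℝ≥0∞} {x₀ u δ : ℝ} (hx₀ : 0 < x₀) (hδ : 0 ≤ δ)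
    (hU : Measurable U) (h : ∀ x ∈ Ioo 0 x₀, F x ≤ U x) :
    negMoment F (u + δ) ≤ (∫⁻ x in Ioo 0 x₀, ENNReal.ofReal (x ^ (-(u + δ))) * U x) +
      ENNReal.ofReal (x₀ ^ (-δ)) * negMoment F u := by
  rw [negMoment, negMoment, ← lintegral_const_mul' _ _ ENNReal.ofReal_ne_top,
    ← lintegral_indicator measurableSet_Ioo, ← lintegral_indicator measurableSet_Ioi,
    ← lintegral_indicator measurableSet_Ioi, ← lintegral_add_left
      ((by fun_prop : Measurable fun x => ENNReal.ofReal (x ^ (-(u + δ))) * U x).indicator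
        measurableSet_Ioo)]
  refine lintegral_mono fun x => ?_
  by_cases hx : 0 < x
  · have hx0 : x ∈ Ioi (0 : ℝ) := hx
    rw [indicator_of_mem hx0, indicator_of_mem hx0]
    by_cases hx' : x < x₀
    · rw [indicator_of_mem (show x ∈ Ioo 0 x₀ from ⟨hx, hx'⟩)]
      exact (mul_le_mul_right (h x ⟨hx, hx'⟩) _).trans le_self_add
    · refine le_add_left ?_
      rw [← mul_assoc, ← ENNReal.ofReal_mul (by positivity), neg_add, add_comm, rpow_add hx]
      gcongr ENNReal.ofReal (?_ * _) * _
      exact rpow_le_rpow_of_nonpos hx₀ (not_lt.1 hx') (neg_nonpos.2 hδ)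
  · rw [indicator_of_notMem (by exact hx)]
    exact zero_le

lemma negMoment_fixedPoint_ne_top {α m x₀ : ℝ} (hα : 0 < α) (hm : α < m) (hx₀ : 0 < x₀)
    {F : ℕ → ℝ → ℝ≥0∞} {U : ℝ → ℝ≥0∞} (hF : ∀ n, Measurable (F n)) (hmono : Monotone F)
    (hsucc : ∀ n, F (n + 1) = fracOp α m (F n)) (hU : Measurable U)
    (hFU : ∀ n, ∀ x ∈ Ioo 0 x₀, F n x ≤ U x)
    (hUfin : ∀ w : ℝ, 0 ≤ w → ∫⁻ x in Ioo 0 x₀, ENNReal.ofReal (x ^ (-w)) * U x ≠ ∞)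
    (h0 : ∀ u, 0 ≤ u → negMoment (F 0) u ≠ ∞)
    (hfix : fracOp α m (fun v => ⨆ n, F n v) = fun v => ⨆ n, F n v) :
    negMoment (fun x => ⨆ n, F n x) 0 ≠ ∞ := by
  have hδ : 0 < m - α := by linarith
  set δ := m - α with hδ'
  have hlim : ∃ k : ℕ, Gamma (k * δ + δ) / Gamma (k * δ + δ + α) * x₀ ^ (-δ) ≤ 1 / 2 := by
    have hseq : Tendsto (fun n : ℕ => n * δ + δ) atTop atTop :=
      tendsto_atTop_add_const_right _ _ (tendsto_natCast_atTop_atTop.atTop_mul_const hδ)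
    obtain ⟨k, hk⟩ := (((tendsto_log_Gamma_add_sub_atTop hα).comp hseq).eventually_ge_atTop
      (log (2 * x₀ ^ (-δ)))).exists
    refine ⟨k, ?_⟩
    have g1 := Gamma_pos_of_pos (show 0 < k * δ + δ by positivity)
    have g2 := Gamma_pos_of_pos (show 0 < k * δ + δ + α by positivity)
    simp only [Function.comp_apply] at hk
    rw [← log_div g2.ne' g1.ne', log_le_log_iff (by positivity) (by positivity),
      le_div_iff₀ g1] at hk
    rw [div_mul_eq_mul_div, div_le_iff₀ g2]
    linarith
  obtain ⟨k, hk⟩ := hlim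
  have hpos (k : ℕ) : 0 < k * δ + δ := by positivity
  have hc (k : ℕ) : 0 < Gamma (k * δ + δ) / Gamma (k * δ + δ + α) :=
    div_pos (Gamma_pos_of_pos (hpos k)) (Gamma_pos_of_pos (by linarith [hpos k]))
  set c := Gamma (k * δ + δ) / Gamma (k * δ + δ + α) with hc'
  set B := ENNReal.ofReal c * ∫⁻ x in Ioo 0 x₀, ENNReal.ofReal (x ^ (-(k * δ + δ))) * U x with hB
  have hBtop : B ≠ ∞ := ENNReal.mul_ne_top ENNReal.ofReal_ne_top (hUfin _ (hpos k).le)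
  have hrec (n : ℕ) : negMoment (F (n + 1)) (k * δ) ≤ B + 2⁻¹ * negMoment (F n) (k * δ) := by
    rw [hsucc, negMoment_fracOp hα (hpos k) (hF n), ← hδ', ← hc']
    refine (mul_le_mul_right (negMoment_add_le hx₀ hδ.le hU (hFU n)) _).trans ?_
    rw [mul_add, ← mul_assoc, ← ENNReal.ofReal_mul (hc k).le]
    gcongr
    refine (ENNReal.ofReal_le_ofReal hk).trans (le_of_eq ?_)
    rw [one_div, ENNReal.ofReal_inv_of_pos two_pos, ENNReal.ofReal_ofNat]
  have hbd (n : ℕ) : negMoment (F n) (k * δ) ≤ 2 * B + negMoment (F 0) (k * δ) := by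
    induction n with
    | zero => exact le_add_self
    | succ n ih =>
      refine (hrec n).trans ?_
      calc B + 2⁻¹ * negMoment (F n) (k * δ)
          ≤ B + 2⁻¹ * (2 * B + negMoment (F 0) (k * δ)) := by gcongr
        _ = 2 * B + 2⁻¹ * negMoment (F 0) (k * δ) := by
          rw [mul_add, ← mul_assoc, ENNReal.inv_mul_cancel two_ne_zero ENNReal.ofNat_ne_top,
            one_mul, ← add_assoc, two_mul]
        _ ≤ 2 * B + 1 * negMoment (F 0) (k * δ) := by
          gcongr
          exact ENNReal.inv_le_one.2 one_le_two
        _ = _ := by rw [one_mul]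
  have hmeas : Measurable fun x => ⨆ n, F n x := Measurable.iSup hF
  have hk' : negMoment (fun x => ⨆ n, F n x) (k * δ) ≠ ∞ := by
    refine ne_top_of_le_ne_top
      (ENNReal.add_ne_top.2 ⟨ENNReal.mul_ne_top (a := 2) ENNReal.ofNat_ne_top hBtop,
        h0 (k * δ) (by positivity)⟩) ?_
    have hmeas' (n : ℕ) : Measurable fun x => ENNReal.ofReal (x ^ (-(k * δ))) * F n x := by
      have := hF n
      fun_prop
    refine le_trans (le_of_eq ?_) (iSup_le hbd)
    simp only [negMoment, ENNReal.mul_iSup]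
    exact lintegral_iSup hmeas' fun i j hij x => mul_le_mul_right (hmono hij x) _
  have hdesc (j : ℕ) (hj : negMoment (fun x => ⨆ n, F n x) (j * δ) ≠ ∞) :
      negMoment (fun x => ⨆ n, F n x) 0 ≠ ∞ := by
    induction j with
    | zero => simpa using hj
    | succ j ih =>
      apply ih
      rw [← hfix, negMoment_fracOp hα (hpos j) hmeas]
      push_cast at hj
      rw [add_one_mul] at hj
      exact ENNReal.mul_ne_top ENNReal.ofReal_ne_top hj
  exact hdesc k hk'

lemma exists_wkb_le {β : ℝ} (hβ : 0 < β) {a : ℝ} (ha : 0 ≤ a) :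
    ∃ C, ∀ x, 0 < x → wkb β a x ≤ C := by
  refine ⟨(a / β / (1 / β)) ^ (a / β), fun x hx => ?_⟩
  have hr : 0 < x ^ (-β) := by positivity
  have h := ProbabilityTheory.rpow_abs_le_mul_max_exp_of_pos (x ^ (-β)) (p := a / β) (t := 1 / β)
    (by positivity) (by positivity)
  rw [abs_of_pos hr, max_eq_left (exp_le_exp.2 (by
    have : 0 < 1 / β * x ^ (-β) := by positivity
    linarith)), ← rpow_mul hx.le, show -β * (a / β) = -a by field_simp] at h
  rw [one_div_mul_eq_div] at h
  rwa [wkb, exp_neg, ← div_eq_mul_inv, div_le_iff₀ (exp_pos _)]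

lemma lintegral_rpow_mul_wkb_ne_top {β p x₀ w : ℝ} (hβ : 0 < β) (hp : 0 ≤ p) (hw : 0 ≤ w)
    {g : ℝ → ℝ} {M : ℝ} (hg : ∀ x ∈ Ioo 0 x₀, g x ≤ M) :
    ∫⁻ x in Ioo 0 x₀, ENNReal.ofReal (x ^ (-w)) * ENNReal.ofReal (wkb β p x * g x) ≠ ∞ := by
  obtain ⟨C, hC⟩ := exists_wkb_le hβ (add_nonneg hp hw)
  refine ne_top_of_le_ne_top ?_ (setLIntegral_mono (g := fun _ => ENNReal.ofReal (C * |M|))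
    measurable_const fun x hx => ?_)
  · rw [setLIntegral_const]
    exact ENNReal.mul_ne_top ENNReal.ofReal_ne_top (by simp)
  · have hx0 : 0 < x := hx.1
    rw [← ENNReal.ofReal_mul (by positivity)]
    refine ENNReal.ofReal_le_ofReal ?_
    have h := hC x hx.1
    rw [show p + w = p - -w by ring, wkb_sub β p (-w) hx.1] at h
    have := wkb_pos β p hx0
    calc x ^ (-w) * (wkb β p x * g x) = wkb β p x * x ^ (-w) * g x := by ring
      _ ≤ wkb β p x * x ^ (-w) * |M| := by
        gcongr
        exact (hg x hx).trans (le_abs_self M)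
      _ ≤ C * |M| := by gcongr

/-- A finite-mass solution of the fractional equation with the expected behaviour at zero. -/
lemma exists_solution_squeezed {α m : ℝ} (hα : 0 < α) (hm : α < m) :
    ∃ F : ℝ → ℝ≥0∞, ∃ η x₀ : ℝ, Measurable F ∧ fracOp α m F = F ∧ negMoment F 0 ≠ 0 ∧
      negMoment F 0 ≠ ∞ ∧ 0 < η ∧ 0 < x₀ ∧ ∀ x ∈ Ioo 0 x₀,
        ENNReal.ofReal (wkb ((m - α) / α) (m * (1 + α) / (2 * α)) x * (1 - x ^ η)) ≤ F x ∧
        F x ≤ ENNReal.ofReal (wkb ((m - α) / α) (m * (1 + α) / (2 * α)) x * (1 + x ^ η)) := by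
  obtain ⟨β, p, η, rfl, rfl, hη, x₀, hx₀, hx₁, hx⟩ := exists_barriers hα hm
  have hβ0 : 0 < (m - α) / α := div_pos (by linarith) hα
  have hp0 : 0 ≤ m * (1 + α) / (2 * α) := by
    have : 0 < m := by linarith
    positivity
  set β := (m - α) / α
  set p := m * (1 + α) / (2 * α)
  have hwm := measurable_wkb β p
  set l : ℝ → ℝ≥0∞ := fun v => ENNReal.ofReal (wkb β p v * (1 - v ^ η)) with hl
  set U : ℝ → ℝ≥0∞ := fun v => ENNReal.ofReal (wkb β p v * (1 + v ^ η)) with hU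
  have hlm : Measurable l := by fun_prop
  have hUm : Measurable U := by fun_prop
  have hL1 : ∀ x, (Ioo 0 x₀).indicator l x ≤ fracOp α m ((Ioo 0 x₀).indicator l) x := by
    intro x
    by_cases h : x ∈ Ioo 0 x₀
    · rw [indicator_of_mem h]
      refine (hx x h).2.2.trans (fracOp_mono fun v hv => ?_)
      rw [indicator_of_mem (show v ∈ Ioo 0 x₀ from ⟨hv.1, hv.2.trans h.2⟩)]
    · rw [indicator_of_notMem h]
      exact zero_le
  have hlU : ∀ x ∈ Ioo 0 x₀, (Ioo 0 x₀).indicator l x ≤ U x := by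
    intro x h
    have h0 := wkb_pos β p h.1
    have h1 : 0 < x ^ η := rpow_pos_of_pos h.1 _
    rw [indicator_of_mem h]
    exact ENNReal.ofReal_le_ofReal (mul_le_mul_of_nonneg_left (by linarith) h0.le)
  obtain ⟨F, hF, hmono, hF0, hsucc, hFU⟩ := exists_fracOp_fixedPoint
    (hlm.indicator measurableSet_Ioo) hL1 (fun x h => (hx x h).2.1) hlU
  have hfix : fracOp α m (fun v => ⨆ n, F n v) = fun v => ⨆ n, F n v := by
    funext x
    rw [fracOp_iSup α m hF hmono]
    simp only [← hsucc]
    exact (show Monotone fun n => F n x from fun i j hij => hmono hij x).iSup_nat_add 1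
  have hlF : ∀ x ∈ Ioo 0 x₀, l x ≤ ⨆ n, F n x := fun x h => by
    refine le_iSup_of_le 0 ?_
    rw [hF0, indicator_of_mem h]
  refine ⟨fun x => ⨆ n, F n x, η, x₀, Measurable.iSup hF, hfix, ?_, ?_, hη, hx₀, fun x h =>
    ⟨hlF x h, iSup_le fun n => hFU n x h⟩⟩
  · rw [negMoment_zero]
    intro h
    have h2 : ∫⁻ x in Ioo 0 x₀, l x = 0 := by
      refine le_antisymm (le_trans ?_ h.le) zero_le
      exact (setLIntegral_mono (Measurable.iSup hF) hlF).trans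
        (lintegral_mono_set Ioo_subset_Ioi_self)
    have h3 : 0 < ∫⁻ x in Ioo 0 x₀, l x := by
      rw [setLIntegral_pos_iff hlm]
      refine lt_of_lt_of_le ?_ (measure_mono (s := Ioo 0 x₀) fun x h => ⟨?_, h⟩)
      · simpa using hx₀
      · have h0 := wkb_pos β p h.1
        have h1 : x ^ η < 1 := rpow_lt_one h.1.le (h.2.trans hx₁) hη
        exact (ENNReal.ofReal_pos.2 (mul_pos h0 (by linarith))).ne'
    exact h3.ne' h2
  · have hUfin : ∀ w : ℝ, 0 ≤ w → ∫⁻ x in Ioo 0 x₀, ENNReal.ofReal (x ^ (-w)) * U x ≠ ∞ :=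
      fun w hw => lintegral_rpow_mul_wkb_ne_top hβ0 hp0 hw (g := fun x => 1 + x ^ η) (M := 2)
        fun x h => by
          linarith [(hx x h).1]
    refine negMoment_fixedPoint_ne_top hα hm hx₀ hF hmono hsucc hUm hFU hUfin (fun u hu => ?_) hfix
    refine ne_top_of_le_ne_top (hUfin u hu) ?_
    rw [hF0, negMoment, ← lintegral_indicator measurableSet_Ioi,
      ← lintegral_indicator measurableSet_Ioo]
    refine lintegral_mono fun x => ?_
    by_cases h : x ∈ Ioo 0 x₀
    · rw [indicator_of_mem h, indicator_of_mem (show x ∈ Ioi 0 from h.1)]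
      exact mul_le_mul_right (hlU x h) _
    · rw [indicator_of_notMem h]
      refine indicator_apply_le' (fun _ => ?_) fun _ => le_rfl
      rw [indicator_of_notMem h, mul_zero]

lemma lintegral_Ioo_sub_rpow_le {α v R : ℝ} (hα : 0 < α) (hv : 0 < v) :
    ∫⁻ x in Ioo v R, ENNReal.ofReal ((x - v) ^ (α - 1)) ≤ ENNReal.ofReal (R ^ α / α) := by
  rcases le_or_gt R v with h | h
  · simp [Ioo_eq_empty_of_le h]
  have hii : IntervalIntegrable (fun x : ℝ => (x - v) ^ (α - 1)) volume v R := by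
    have := (intervalIntegral.intervalIntegrable_rpow' (a := 0) (b := R - v)
      (show -1 < α - 1 by linarith)).comp_sub_right v
    simpa using this
  have hint : IntegrableOn (fun x : ℝ => (x - v) ^ (α - 1)) (Ioo v R) :=
    ((intervalIntegrable_iff_integrableOn_Ioo_of_le h.le).1 hii)
  rw [← ofReal_integral_eq_lintegral_ofReal hint ((ae_restrict_iff' measurableSet_Ioo).2
    (ae_of_all _ fun x hx => rpow_nonneg (by linarith [hx.1]) _))]
  refine ENNReal.ofReal_le_ofReal ?_
  rw [← integral_Ioc_eq_integral_Ioo, ← intervalIntegral.integral_of_le h.le,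
    intervalIntegral.integral_comp_sub_right (fun x => x ^ (α - 1)),
    integral_rpow (Or.inl (by linarith)), sub_self, sub_add_cancel, zero_rpow hα.ne', sub_zero]
  gcongr
  linarith

lemma lintegral_fracOp_ne_top {α m R : ℝ} (hα : 0 < α) {F : ℝ → ℝ≥0∞} (hF : Measurable F)
    (hF0 : ∫⁻ v in Ioi 0, F v ≠ ∞) :
    ∫⁻ x in Ioo 0 R, ENNReal.ofReal (x ^ m) * fracOp α m F x ≠ ∞ := by
  have hΓ := Gamma_pos_of_pos hα
  have hK := measurable_fracKernel α m
  have hle (v : ℝ) : ∫⁻ x in Ioo 0 R, ENNReal.ofReal (x ^ m) * (fracKernel α m (x, v) * F v) ≤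
      ENNReal.ofReal (R ^ α / α / Gamma α) * (Ioi 0).indicator F v := by
    by_cases hv : 0 < v
    · rw [indicator_of_mem (show v ∈ Ioi 0 from hv), div_eq_mul_inv _ (Gamma α),
        ENNReal.ofReal_mul' (by positivity)]
      calc _ = ∫⁻ x in Ioo v R, ENNReal.ofReal ((x - v) ^ (α - 1)) *
            (ENNReal.ofReal (Gamma α)⁻¹ * F v) := by
            rw [← lintegral_indicator measurableSet_Ioo, ← lintegral_indicator measurableSet_Ioo]
            refine lintegral_congr fun x => ?_
            by_cases hx : x ∈ Ioo v R
            · have hx0 : 0 < x := hv.trans hx.1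
              have hxv : 0 < x - v := by linarith [hx.1]
              have hker : fracKernel α m (x, v) =
                  ENNReal.ofReal ((x - v) ^ (α - 1) / (Gamma α * x ^ m)) :=
                indicator_of_mem (s := {p : ℝ × ℝ | 0 < p.2 ∧ p.2 < p.1}) ⟨hv, hx.1⟩ _
              rw [indicator_of_mem hx, indicator_of_mem (show x ∈ Ioo 0 R from ⟨hx0, hx.2⟩), hker,
                ← mul_assoc, ← mul_assoc, ← ENNReal.ofReal_mul (by positivity),
                ← ENNReal.ofReal_mul (by positivity)]
              congr 2
              field_simp
            · rw [indicator_of_notMem hx]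
              by_cases hx' : x ∈ Ioo 0 R
              · have hker : fracKernel α m (x, v) = 0 :=
                  indicator_of_notMem (fun h => hx ⟨h.2, hx'.2⟩) _
                rw [indicator_of_mem hx', hker]
                simp
              · rw [indicator_of_notMem hx']
        _ = (∫⁻ x in Ioo v R, ENNReal.ofReal ((x - v) ^ (α - 1))) *
            (ENNReal.ofReal (Gamma α)⁻¹ * F v) := lintegral_mul_const _ (by fun_prop)
        _ ≤ ENNReal.ofReal (R ^ α / α) * (ENNReal.ofReal (Gamma α)⁻¹ * F v) := by
            gcongr
            exact lintegral_Ioo_sub_rpow_le hα hv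
        _ = _ := (mul_assoc _ _ _).symm
    · have hker (x : ℝ) : fracKernel α m (x, v) = 0 := indicator_of_notMem (fun h => hv h.1) _
      simp [hker]
  refine ne_top_of_le_ne_top (ENNReal.mul_ne_top
    (ENNReal.ofReal_ne_top (r := R ^ α / α / Gamma α)) hF0) ?_
  calc _ = ∫⁻ x in Ioo 0 R, ∫⁻ v, ENNReal.ofReal (x ^ m) * (fracKernel α m (x, v) * F v) := by
        refine lintegral_congr fun x => ?_
        rw [fracOp, lintegral_const_mul' _ _ ENNReal.ofReal_ne_top]
    _ = ∫⁻ v, ∫⁻ x in Ioo 0 R, ENNReal.ofReal (x ^ m) * (fracKernel α m (x, v) * F v) := by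
        refine lintegral_lintegral_swap (Measurable.aemeasurable ?_)
        simp only [Function.uncurry_def]
        fun_prop
    _ ≤ ∫⁻ v, ENNReal.ofReal (R ^ α / α / Gamma α) * (Ioi 0).indicator F v := lintegral_mono hle
    _ = _ := by
        rw [lintegral_const_mul' _ _ ENNReal.ofReal_ne_top, lintegral_indicator measurableSet_Ioi]

lemma ae_fracOp_ne_top {α m : ℝ} (hα : 0 < α) {F : ℝ → ℝ≥0∞} (hF : Measurable F)
    (hF0 : ∫⁻ v in Ioi 0, F v ≠ ∞) :
    ∀ᵐ x ∂volume.restrict (Ioi (0 : ℝ)), fracOp α m F x ≠ ∞ := by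
  have hmeas := measurable_fracOp α m hF
  have h (n : ℕ) : ∀ᵐ x, x ∈ Ioo 0 (n : ℝ) → fracOp α m F x ≠ ∞ := by
    have := ae_lt_top (by fun_prop) (lintegral_fracOp_ne_top (m := m) (R := n) hα hF hF0)
    rw [ae_restrict_iff' measurableSet_Ioo] at this
    filter_upwards [this] with x hx hxn htop
    have := hx hxn
    rw [htop, ENNReal.mul_top (ENNReal.ofReal_pos.2 (rpow_pos_of_pos hxn.1 _)).ne'] at this
    exact lt_irrefl _ this
  rw [ae_restrict_iff' measurableSet_Ioi]
  filter_upwards [ae_all_iff.2 h] with x hx hx0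
  obtain ⟨n, hn⟩ := exists_nat_gt x
  exact hx n ⟨hx0, hn⟩

namespace IsDensitySolution

variable {α m : ℝ} {f : ℝ → ℝ}

lemma eq_toReal_fracOp (hf : IsDensitySolution α m f) (hα : 0 < α) {x : ℝ} (hx : 0 < x) :
    f x = (fracOp α m (fun v => ENNReal.ofReal (f v)) x).toReal := by
  obtain ⟨hm, h0, -, heq⟩ := hf
  have hΓ := Gamma_pos_of_pos hα
  have hxm : 0 < x ^ m := by positivity
  have e : f x = ∫ v in Ioo 0 x, (x - v) ^ (α - 1) / (Gamma α * x ^ m) * f v := by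
    have h := heq x hx
    have e2 : ∀ v, (x - v) ^ (α - 1) / (Gamma α * x ^ m) * f v =
        (Gamma α * x ^ m)⁻¹ * ((x - v) ^ (α - 1) * f v) := fun v => by ring
    simp only [e2]
    rw [integral_const_mul, mul_inv, mul_right_comm, ← one_div, ← h]
    field_simp
  rw [e, integral_eq_lintegral_of_nonneg_ae, fracOp_eq]
  · congr 1
    refine setLIntegral_congr_fun measurableSet_Ioo fun v hv => ?_
    have : 0 < x - v := by linarith [hv.2]
    exact ENNReal.ofReal_mul (by positivity)
  · refine (ae_restrict_iff' measurableSet_Ioo).2 (ae_of_all _ fun v hv => ?_)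
    have : 0 < x - v := by linarith [hv.2]
    have := h0 v hv.1
    simp only [Pi.zero_apply]
    positivity
  · exact Measurable.aestronglyMeasurable (by fun_prop)

lemma isFracDensity (hf : IsDensitySolution α m f) (hα : 0 < α) :
    IsFracDensity α m fun v => ENNReal.ofReal (f v) := by
  have hmeas : Measurable fun v => ENNReal.ofReal (f v) := hf.1.ennreal_ofReal
  have hmass : ∫⁻ v in Ioi 0, ENNReal.ofReal (f v) = 1 := by
    have hint : Integrable f (volume.restrict (Ioi 0)) := by
      by_contra h
      have := hf.2.2.1
      rw [integral_undef h] at this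
      exact zero_ne_one this
    rw [← ofReal_integral_eq_lintegral_ofReal hint
      ((ae_restrict_iff' measurableSet_Ioi).2 (ae_of_all _ hf.2.1)), hf.2.2.1, ENNReal.ofReal_one]
  refine ⟨hmeas, ?_, by rw [negMoment_zero, hmass]⟩
  filter_upwards [ae_fracOp_ne_top (m := m) hα hmeas (by simp [hmass]),
    ae_restrict_mem measurableSet_Ioi] with x hx hx0
  rw [hf.eq_toReal_fracOp hα hx0, ENNReal.ofReal_toReal hx]

end IsDensitySolution

lemma fracOp_const_mul (α m : ℝ) {c : ℝ≥0∞} (hc : c ≠ ∞) (F : ℝ → ℝ≥0∞) (x : ℝ) :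
    fracOp α m (fun v => c * F v) x = c * fracOp α m F x := by
  simp only [fracOp, mul_left_comm _ c]
  exact lintegral_const_mul' _ _ hc

lemma fracOp_congr_ae {α m : ℝ} {F G : ℝ → ℝ≥0∞}
    (h : ∀ᵐ x ∂volume.restrict (Ioi (0 : ℝ)), F x = G x) (x : ℝ) :
    fracOp α m F x = fracOp α m G x := by
  rw [fracOp_eq, fracOp_eq]
  refine lintegral_congr_ae ?_
  filter_upwards [ae_restrict_of_ae_restrict_of_subset Ioo_subset_Ioi_self h] with v hv
  rw [hv]

/-- Asymptotics at zero: there is `c > 0` with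
`f(x) ∼ c x^{−m(1+α)/(2α)} exp(−(α/(m−α)) x^{(α−m)/α})` as `x → 0+`. -/
theorem density_solution_asymptotic_at_zero (α m : ℝ) (hα : 0 < α) (hm : α < m)
    (f : ℝ → ℝ) (hf : IsDensitySolution α m f) :
    ∃ c : ℝ, 0 < c ∧
      Filter.Tendsto
        (fun x : ℝ => f x * x ^ (m * (1 + α) / (2 * α)) *
          Real.exp ((α / (m - α)) * x ^ ((α - m) / α)))
        (nhdsWithin 0 (Set.Ioi (0:ℝ))) (nhds c) := by
  obtain ⟨F, η, x₀, hF, hfix, hN0, hNtop, hη, hx₀, hsq⟩ := exists_solution_squeezed hα hm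
  set N := negMoment F 0 with hN
  have hNinv : N⁻¹ ≠ ∞ := ENNReal.inv_ne_top.2 hN0
  have hG : IsFracDensity α m fun v => N⁻¹ * F v := by
    refine ⟨by fun_prop, ae_of_all _ fun x => ?_, ?_⟩
    · rw [fracOp_const_mul α m hNinv, hfix]
    · rw [negMoment_zero, lintegral_const_mul' _ _ hNinv, ← negMoment_zero, ← hN,
        ENNReal.inv_mul_cancel hN0 hNtop]
  have huniq := (hf.isFracDensity hα).unique hG hα hm
  have hc : 0 < (N⁻¹).toReal := ENNReal.toReal_pos (ENNReal.inv_ne_zero.2 hNtop) hNinv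
  refine ⟨(N⁻¹).toReal, hc, ?_⟩
  set β := (m - α) / α with hβ
  set p := m * (1 + α) / (2 * α) with hp
  have hf_eq {x : ℝ} (hx : 0 < x) : f x = (N⁻¹).toReal * (F x).toReal := by
    rw [hf.eq_toReal_fracOp hα hx, fracOp_congr_ae huniq, fracOp_const_mul α m hNinv, hfix,
      ENNReal.toReal_mul]
  have hmα : m - α ≠ 0 := by linarith
  have hE {x : ℝ} (hx : 0 < x) : x ^ p * rexp ((α / (m - α)) * x ^ ((α - m) / α)) =
      (wkb β p x)⁻¹ := by
    rw [wkb, mul_inv, rpow_neg hx.le, inv_inv, ← exp_neg, neg_neg,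
      show (α - m) / α = -β by rw [hβ]; ring]
    congr 2
    rw [hβ]
    field_simp
  have hlim : Tendsto (fun x : ℝ => x ^ η) (𝓝[>] 0) (𝓝 0) := by
    have := (continuousAt_rpow_const 0 η (Or.inr hη.le)).tendsto
    rw [zero_rpow hη.ne'] at this
    exact this.mono_left nhdsWithin_le_nhds
  have hlow : Tendsto (fun x : ℝ => (N⁻¹).toReal * (1 - x ^ η)) (𝓝[>] 0) (𝓝 (N⁻¹).toReal) := by
    simpa using (hlim.const_sub 1).const_mul (N⁻¹).toReal
  have hup : Tendsto (fun x : ℝ => (N⁻¹).toReal * (1 + x ^ η)) (𝓝[>] 0) (𝓝 (N⁻¹).toReal) := by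
    simpa using (hlim.const_add 1).const_mul (N⁻¹).toReal
  have hmem : ∀ᶠ x in 𝓝[>] (0 : ℝ), x ∈ Ioo 0 x₀ := Ioo_mem_nhdsGT hx₀
  refine tendsto_of_tendsto_of_tendsto_of_le_of_le' hlow hup ?_ ?_ <;>
    filter_upwards [hmem] with x hx
  all_goals
    have hw := wkb_pos β p hx.1
    obtain ⟨h1, h2⟩ := hsq x hx
    have hη0 : 0 < x ^ η := rpow_pos_of_pos hx.1 _
    rw [mul_assoc (f x), hE hx.1, hf_eq hx.1, mul_assoc]
    refine mul_le_mul_of_nonneg_left ?_ hc.le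
  · rw [← div_eq_mul_inv, le_div_iff₀ hw, mul_comm]
    exact (ENNReal.ofReal_le_iff_le_toReal (ne_top_of_le_ne_top ENNReal.ofReal_ne_top h2)).1 h1
  · rw [← div_eq_mul_inv, div_le_iff₀ hw, mul_comm _ (wkb β p x)]
    exact ENNReal.toReal_le_of_le_ofReal (by positivity) h2
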